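/- arXiv:2209.10432 — 2 statements merged into one kernel-verified Lean document; each statement's English description precedes it below -/
import Mathlib

section
/- For every γ ≥ 1 there exists a constant C such that for every nondegenerate triangle K ⊂ ℝ² with shape-regularity ratio h_K/ρ_K ≤ γ and every twice continuously differentiable vector field E on a neighborhood of K, the curl of the Nédélec interpolation error satisfies ‖curl(E − Π_K E)‖_{L²(K)} ≤ C h_K ‖curl E‖_{H¹(K)}. -/
open MeasureTheory

/-- Euclidean scalar product on ℝ². -/
noncomputable def dot (u v : ℝ × ℝ) : ℝ := u.1 * v.1 + u.2 * v.2

/-- Euclidean diameter of a set in ℝ². -/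
noncomputable def ediam (K : Set (ℝ × ℝ)) : ℝ :=
  sSup {d : ℝ | ∃ u ∈ K, ∃ v ∈ K, d = Real.sqrt (dot (u - v) (u - v))}

/-- Euclidean inradius: supremum of radii of (closed Euclidean) balls contained in `K`. -/
noncomputable def einrad (K : Set (ℝ × ℝ)) : ℝ :=
  sSup {r : ℝ | 0 ≤ r ∧ ∃ x : ℝ × ℝ, {y | Real.sqrt (dot (y - x) (y - x)) ≤ r} ⊆ K}

/-- Edge functional: `∫_e v ⬝ t ds = ∫_0^1 v(q₀ + s(q₁−q₀)) ⬝ (q₁−q₀) ds`. -/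
noncomputable def edgeInt (v : ℝ × ℝ → ℝ × ℝ) (q₀ q₁ : ℝ × ℝ) : ℝ :=
  ∫ s in (0 : ℝ)..1, dot (v (q₀ + s • (q₁ - q₀))) (q₁ - q₀)

/-- Scalar curl in 2D: `curl E = ∂ₓE₂ − ∂_y E₁`. -/
noncomputable def curl2 (E : ℝ × ℝ → ℝ × ℝ) (x : ℝ × ℝ) : ℝ :=
  (fderiv ℝ E x (1, 0)).2 - (fderiv ℝ E x (0, 1)).1

lemma lintegral_comp_smul_add {g : ℝ × ℝ → ENNReal} (hg : Measurable g) {t : ℝ} (ht : t ≠ 0)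
    (c : ℝ × ℝ) :
    ∫⁻ x, g (t • x + c) = ENNReal.ofReal |(t ^ 2)⁻¹| * ∫⁻ x, g x := by
  have hm : Measurable fun z : ℝ × ℝ => g (z + c) := hg.comp (measurable_add_const c)
  have h := lintegral_map hm (measurable_const_smul t) (μ := (volume : Measure (ℝ × ℝ)))
  rw [Measure.map_addHaar_smul _ ht, lintegral_smul_measure, lintegral_add_right_eq_self g c] at h
  simpa using h.symm

lemma lintegral_comp_smul_add_le {g : ℝ × ℝ → ENNReal} (hg : Measurable g) {t : ℝ}
    (ht : 1 / 2 ≤ t) (c : ℝ × ℝ) : ∫⁻ x, g (t • x + c) ≤ 4 * ∫⁻ x, g x := by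
  rw [lintegral_comp_smul_add hg (by linarith) c]
  gcongr
  rw [ENNReal.ofReal_le_iff_le_toReal (by simp), abs_of_nonneg (by positivity)]
  have h : (1 / 2 : ℝ) ^ 2 ≤ t ^ 2 := by gcongr
  have := inv_anti₀ (by norm_num) h
  norm_num at this ⊢
  linarith

lemma lintegral_lintegral_segment_le {g : ℝ × ℝ → ENNReal} (hg : Measurable g)
    (K : Set (ℝ × ℝ)) (t : ℝ) :
    ∫⁻ x in K, ∫⁻ y in K, g (t • x + (1 - t) • y) ≤ 4 * volume K * ∫⁻ x, g x := by
  have key : ∀ s : ℝ, 1 / 2 ≤ s →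
      ∫⁻ x in K, ∫⁻ y in K, g (s • y + (1 - s) • x) ≤ 4 * volume K * ∫⁻ x, g x := by
    intro s hs
    calc ∫⁻ x in K, ∫⁻ y in K, g (s • y + (1 - s) • x)
        ≤ ∫⁻ x in K, 4 * ∫⁻ x, g x := by
          gcongr with x
          exact (setLIntegral_le_lintegral _ _).trans (lintegral_comp_smul_add_le hg hs _)
      _ = 4 * volume K * ∫⁻ x, g x := by
          rw [setLIntegral_const]; ring
  rcases le_total (1 / 2) t with ht | ht
  · rw [lintegral_lintegral_swap (by
      have : Measurable fun z : (ℝ × ℝ) × (ℝ × ℝ) => g (t • z.1 + (1 - t) • z.2) := by fun_prop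
      exact this.aemeasurable)]
    exact key t ht
  · have h := key (1 - t) (by linarith)
    simpa [add_comm] using h

lemma sq_intervalIntegral_le {f : ℝ → ℝ} (hf : ContinuousOn f (Set.Icc 0 1)) :
    (∫ t in (0 : ℝ)..1, f t) ^ 2 ≤ ∫ t in (0 : ℝ)..1, f t ^ 2 := by
  have hf' : ContinuousOn f (Set.uIcc 0 1) := by rwa [Set.uIcc_of_le zero_le_one]
  set M := ∫ t in (0 : ℝ)..1, f t with hM
  have h0 : 0 ≤ ∫ t in (0 : ℝ)..1, (f t - M) ^ 2 :=
    intervalIntegral.integral_nonneg zero_le_one fun t _ => sq_nonneg _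
  have h1 : ∫ t in (0 : ℝ)..1, (f t - M) ^ 2
      = (∫ t in (0 : ℝ)..1, f t ^ 2) - 2 * M * M + M ^ 2 := by
    have : ∀ t, (f t - M) ^ 2 = f t ^ 2 - 2 * M * f t + M ^ 2 := fun t => by ring
    simp_rw [this]
    rw [intervalIntegral.integral_add, intervalIntegral.integral_sub,
      intervalIntegral.integral_const_mul, ← hM]
    · simp
    · exact (hf'.pow 2).intervalIntegrable
    · exact (hf'.const_smul (2 * M)).intervalIntegrable
    · exact ((hf'.pow 2).sub (hf'.const_smul (2 * M))).intervalIntegrable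
    · simp
  nlinarith

lemma le_ediam {K : Set (ℝ × ℝ)} (hK : IsCompact K) {x y : ℝ × ℝ} (hx : x ∈ K) (hy : y ∈ K) :
    Real.sqrt (dot (x - y) (x - y)) ≤ ediam K := by
  refine le_csSup ?_ ⟨x, hx, y, hy, rfl⟩
  have hc : Continuous fun z : (ℝ × ℝ) × (ℝ × ℝ) => Real.sqrt (dot (z.1 - z.2) (z.1 - z.2)) := by
    unfold dot; fun_prop
  refine ((hK.prod hK).bddAbove_image hc.continuousOn).mono ?_
  rintro d ⟨u, hu, v, hv, rfl⟩
  exact ⟨(u, v), ⟨hu, hv⟩, rfl⟩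

lemma dot_self_sub_le {K : Set (ℝ × ℝ)} (hK : IsCompact K) {x y : ℝ × ℝ} (hx : x ∈ K)
    (hy : y ∈ K) : dot (x - y) (x - y) ≤ ediam K ^ 2 := by
  rw [← Real.sqrt_le_left ((Real.sqrt_nonneg _).trans (le_ediam hK hx hy))]
  exact le_ediam hK hx hy

/-- Squared Euclidean norm of the gradient. -/
noncomputable def gradSq (w : ℝ × ℝ → ℝ) (x : ℝ × ℝ) : ℝ :=
  fderiv ℝ w x (1, 0) ^ 2 + fderiv ℝ w x (0, 1) ^ 2

lemma gradSq_nonneg (w : ℝ × ℝ → ℝ) (x : ℝ × ℝ) : 0 ≤ gradSq w x := by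
  unfold gradSq; positivity

lemma continuousOn_gradSq {w : ℝ × ℝ → ℝ} {U : Set (ℝ × ℝ)} (hU : IsOpen U)
    (hw : ContDiffOn ℝ 1 w U) : ContinuousOn (gradSq w) U := by
  have h := hw.continuousOn_fderiv_of_isOpen hU le_rfl
  exact ((h.clm_apply continuousOn_const).pow 2).add ((h.clm_apply continuousOn_const).pow 2)

lemma sq_apply_le (L : ℝ × ℝ →L[ℝ] ℝ) (v : ℝ × ℝ) :
    L v ^ 2 ≤ (L (1, 0) ^ 2 + L (0, 1) ^ 2) * dot v v := by
  have h : L v = v.1 * L (1, 0) + v.2 * L (0, 1) := by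
    have : v = v.1 • ((1 : ℝ), (0 : ℝ)) + v.2 • ((0 : ℝ), (1 : ℝ)) := by ext <;> simp
    calc L v = L (v.1 • ((1 : ℝ), (0 : ℝ)) + v.2 • ((0 : ℝ), (1 : ℝ))) := congrArg L this
      _ = v.1 * L (1, 0) + v.2 * L (0, 1) := by rw [map_add, map_smul, map_smul]; rfl
  rw [h, dot]
  nlinarith [sq_nonneg (v.1 * L (0, 1) - v.2 * L (1, 0))]

lemma sq_sub_le_integral_gradSq {K U : Set (ℝ × ℝ)} (hK : IsCompact K) (hconv : Convex ℝ K)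
    (hU : IsOpen U) (hKU : K ⊆ U) {w : ℝ × ℝ → ℝ} (hw : ContDiffOn ℝ 1 w U)
    {x y : ℝ × ℝ} (hx : x ∈ K) (hy : y ∈ K) :
    (w x - w y) ^ 2
      ≤ ediam K ^ 2 * ∫ t in (0 : ℝ)..1, gradSq w (t • x + (1 - t) • y) := by
  have hmem : ∀ t ∈ Set.Icc (0 : ℝ) 1, t • x + (1 - t) • y ∈ K := fun t ht =>
    hconv hx hy ht.1 (by linarith [ht.2]) (by ring)
  have hmaps : Set.MapsTo (fun t : ℝ => t • x + (1 - t) • y) (Set.Icc 0 1) U :=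
    fun t ht => hKU (hmem t ht)
  have hcont : ContinuousOn (fun t : ℝ => t • x + (1 - t) • y) (Set.Icc 0 1) := by fun_prop
  have hder : ∀ t ∈ Set.uIcc (0 : ℝ) 1, HasDerivAt (fun t : ℝ => w (t • x + (1 - t) • y))
      (fderiv ℝ w (t • x + (1 - t) • y) (x - y)) t := by
    intro t ht
    rw [Set.uIcc_of_le zero_le_one] at ht
    have h1 : HasFDerivAt w (fderiv ℝ w (t • x + (1 - t) • y)) (t • x + (1 - t) • y) :=
      ((hw.differentiableOn one_ne_zero).differentiableAt
        (hU.mem_nhds (hmaps ht))).hasFDerivAt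
    have h2 : HasDerivAt (fun t : ℝ => t • x + (1 - t) • y) (x - y) t := by
      exact (((hasDerivAt_id' t).smul_const x).fun_add
        (((hasDerivAt_id' t).const_sub 1).smul_const y)).congr_deriv (by simp [sub_eq_add_neg])
    exact h1.comp_hasDerivAt t h2
  have hfc : ContinuousOn (fun t : ℝ => fderiv ℝ w (t • x + (1 - t) • y) (x - y))
      (Set.Icc 0 1) :=
    ((hw.continuousOn_fderiv_of_isOpen hU le_rfl).comp hcont hmaps).clm_apply continuousOn_const
  have hgc : ContinuousOn (fun t : ℝ => gradSq w (t • x + (1 - t) • y)) (Set.Icc 0 1) :=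
    (continuousOn_gradSq hU hw).comp hcont hmaps
  have hu : Set.uIcc (0 : ℝ) 1 = Set.Icc 0 1 := Set.uIcc_of_le zero_le_one
  have hI := intervalIntegral.integral_eq_sub_of_hasDerivAt hder
    (ContinuousOn.intervalIntegrable (by rwa [hu]))
  have : w x - w y = ∫ t in (0 : ℝ)..1, fderiv ℝ w (t • x + (1 - t) • y) (x - y) := by
    rw [hI]; simp
  rw [this, ← intervalIntegral.integral_const_mul]
  refine (sq_intervalIntegral_le hfc).trans ?_
  refine intervalIntegral.integral_mono_on zero_le_one
    (ContinuousOn.intervalIntegrable (by rw [hu]; exact hfc.pow 2))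
    (ContinuousOn.intervalIntegrable (by rw [hu]; exact hgc.const_smul (ediam K ^ 2))) ?_
  intro t _
  rw [mul_comm]
  exact (sq_apply_le _ _).trans
    (mul_le_mul_of_nonneg_left (dot_self_sub_le hK hx hy) (gradSq_nonneg w _))

/-- Poincaré inequality for convex sets: the mean value `m` satisfies
`‖w - m‖² ≤ 2 h² ‖∇w‖²`. -/
lemma integral_sub_mean_sq_le {K U : Set (ℝ × ℝ)} (hK : IsCompact K) (hconv : Convex ℝ K)
    (hU : IsOpen U) (hKU : K ⊆ U) {w : ℝ × ℝ → ℝ} (hw : ContDiffOn ℝ 1 w U) {m : ℝ}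
    (hm : ∫ x in K, w x = ∫ _ in K, m) :
    ∫ x in K, (w x - m) ^ 2 ≤ 2 * ediam K ^ 2 * ∫ x in K, gradSq w x := by
  have hKm : MeasurableSet K := hK.measurableSet
  have hwc : ContinuousOn w K := hw.continuousOn.mono hKU
  have hgc : ContinuousOn (gradSq w) K := (continuousOn_gradSq hU hw).mono hKU
  have hfin : volume K ≠ ⊤ := hK.measure_lt_top.ne
  set V := volume.real K with hV
  have hV0 : 0 ≤ V := measureReal_nonneg
  set S := ∫ x in K, (w x - m) ^ 2 with hS
  have hS0 : 0 ≤ S := integral_nonneg fun x => sq_nonneg _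
  set G := ∫ x in K, gradSq w x with hG
  have hG0 : 0 ≤ G := integral_nonneg fun x => gradSq_nonneg w x
  have hf0 : ∫ x in K, (w x - m) = 0 := by
    rw [integral_sub (hwc.integrableOn_compact hK)
      (continuousOn_const.integrableOn_compact hK), hm, sub_self]
  have hfi : IntegrableOn (fun x => w x - m) K :=
    (hwc.sub continuousOn_const).integrableOn_compact hK
  have hf2i : IntegrableOn (fun x => (w x - m) ^ 2) K :=
    ((hwc.sub continuousOn_const).pow 2).integrableOn_compact hK
  have hci : ∀ c : ℝ, IntegrableOn (fun _ : ℝ × ℝ => c) K := fun c =>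
    continuousOn_const.integrableOn_compact hK
  have hinner : ∀ x ∈ K, ∫ y in K, (w x - w y) ^ 2 = (w x - m) ^ 2 * V + S := by
    intro x _
    have : ∀ y, (w x - w y) ^ 2
        = (w x - m) ^ 2 - 2 * (w x - m) * (w y - m) + (w y - m) ^ 2 := fun y => by ring
    simp_rw [this]
    have hi : IntegrableOn (fun y => (w x - m) ^ 2 - 2 * (w x - m) * (w y - m)) K :=
      (hci _).sub (hfi.const_mul _)
    rw [integral_add hi hf2i, integral_sub (hci _) (hfi.const_mul _), integral_const_mul, hf0, setIntegral_const]
    simp only [smul_eq_mul]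
    ring
  have hL : ∫⁻ x in K, ∫⁻ y in K, ENNReal.ofReal ((w x - w y) ^ 2)
      = ENNReal.ofReal (2 * V * S) := by
    have h1 : ∫⁻ x in K, ∫⁻ y in K, ENNReal.ofReal ((w x - w y) ^ 2)
        = ∫⁻ x in K, ENNReal.ofReal ((w x - m) ^ 2 * V + S) := by
      refine setLIntegral_congr_fun hKm fun x hx => ?_
      have hi : IntegrableOn (fun y => (w x - w y) ^ 2) K :=
        ((continuousOn_const.sub hwc).pow 2).integrableOn_compact hK
      rw [← hinner x hx, ofReal_integral_eq_lintegral_ofReal hi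
        (Filter.Eventually.of_forall fun y => sq_nonneg _)]
    have hi : IntegrableOn (fun x => (w x - m) ^ 2 * V + S) K :=
      (hf2i.mul_const _).add (hci _)
    rw [h1, ← ofReal_integral_eq_lintegral_ofReal hi
      (Filter.Eventually.of_forall fun x => add_nonneg (mul_nonneg (sq_nonneg _) hV0) hS0),
      integral_add (hf2i.mul_const _) (hci _), integral_mul_const, setIntegral_const]
    congr 1
    simp only [smul_eq_mul, ← hS, ← hV]
    ring
  set g : ℝ × ℝ → ENNReal := K.indicator fun x => ENNReal.ofReal (gradSq w x) with hg
  have hgm : Measurable g := by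
    classical
    rw [hg, ← Set.piecewise_eq_indicator]
    exact ContinuousOn.measurable_piecewise (ENNReal.continuous_ofReal.comp_continuousOn hgc)
      continuousOn_const hKm
  have hgG : ∫⁻ x, g x = ENNReal.ofReal G := by
    rw [hg, lintegral_indicator hKm, hG, ofReal_integral_eq_lintegral_ofReal
      (hgc.integrableOn_compact hK) (Filter.Eventually.of_forall fun x => gradSq_nonneg w x)]
  have hpt : ∀ x ∈ K, ∀ y ∈ K, ENNReal.ofReal ((w x - w y) ^ 2)
      ≤ ENNReal.ofReal (ediam K ^ 2)
        * ∫⁻ t in Set.Ioc (0 : ℝ) 1, g (t • x + (1 - t) • y) := by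
    intro x hx y hy
    have hmem : ∀ t ∈ Set.Icc (0 : ℝ) 1, t • x + (1 - t) • y ∈ K := fun t ht =>
      hconv hx hy ht.1 (by linarith [ht.2]) (by ring)
    have h := sq_sub_le_integral_gradSq hK hconv hU hKU hw hx hy
    refine (ENNReal.ofReal_le_ofReal h).trans ?_
    rw [ENNReal.ofReal_mul (sq_nonneg _), intervalIntegral.integral_of_le zero_le_one,
      ofReal_integral_eq_lintegral_ofReal]
    · refine le_of_eq ?_
      congr 1
      refine setLIntegral_congr_fun measurableSet_Ioc fun t ht => ?_
      simp only [hg]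
      rw [Set.indicator_of_mem (hmem t (Set.Ioc_subset_Icc_self ht))]
    · have hc : ContinuousOn (fun t : ℝ => gradSq w (t • x + (1 - t) • y)) (Set.Icc 0 1) :=
        hgc.comp (by fun_prop) hmem
      exact (hc.integrableOn_compact isCompact_Icc).mono_set Set.Ioc_subset_Icc_self
    · exact Filter.Eventually.of_forall fun t => gradSq_nonneg w _
  have hR : ∫⁻ x in K, ∫⁻ y in K, ENNReal.ofReal ((w x - w y) ^ 2)
      ≤ ENNReal.ofReal (ediam K ^ 2 * (4 * V * G)) := by
    calc ∫⁻ x in K, ∫⁻ y in K, ENNReal.ofReal ((w x - w y) ^ 2)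
        ≤ ∫⁻ x in K, ∫⁻ y in K, ENNReal.ofReal (ediam K ^ 2)
          * ∫⁻ t in Set.Ioc (0 : ℝ) 1, g (t • x + (1 - t) • y) :=
          setLIntegral_mono' hKm fun x hx => setLIntegral_mono' hKm fun y hy => hpt x hx y hy
      _ = ENNReal.ofReal (ediam K ^ 2) * ∫⁻ t in Set.Ioc (0 : ℝ) 1,
          ∫⁻ x in K, ∫⁻ y in K, g (t • x + (1 - t) • y) := by
          have e1 : ∀ x, ∫⁻ y in K, ENNReal.ofReal (ediam K ^ 2)
              * ∫⁻ t in Set.Ioc (0 : ℝ) 1, g (t • x + (1 - t) • y)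
              = ENNReal.ofReal (ediam K ^ 2) * ∫⁻ t in Set.Ioc (0 : ℝ) 1, ∫⁻ y in K,
                g (t • x + (1 - t) • y) := by
            intro x
            rw [lintegral_const_mul' _ _ (by simp), lintegral_lintegral_swap]
            have : Measurable fun z : (ℝ × ℝ) × ℝ => g (z.2 • x + (1 - z.2) • z.1) := by
              fun_prop
            exact this.aemeasurable
          simp_rw [e1]
          rw [lintegral_const_mul' _ _ (by simp), lintegral_lintegral_swap]
          have h3 : Measurable fun z : ((ℝ × ℝ) × ℝ) × (ℝ × ℝ) =>
            g (z.1.2 • z.1.1 + (1 - z.1.2) • z.2) := by fun_prop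
          exact (h3.lintegral_prod_right' (ν := volume.restrict K)).aemeasurable
      _ ≤ ENNReal.ofReal (ediam K ^ 2) * ∫⁻ t in Set.Ioc (0 : ℝ) 1,
          4 * volume K * ∫⁻ x, g x := by
          gcongr with t
          exact lintegral_lintegral_segment_le hgm K t
      _ = ENNReal.ofReal (ediam K ^ 2 * (4 * V * G)) := by
          rw [setLIntegral_const, hgG, ENNReal.ofReal_mul (sq_nonneg _),
            ENNReal.ofReal_mul (by positivity), ENNReal.ofReal_mul (by norm_num), hV,
            ofReal_measureReal hfin]
          simp
  rw [hL, ENNReal.ofReal_le_ofReal_iff (by positivity)] at hR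
  rcases hV0.eq_or_lt with h | h
  · have : volume K = 0 := by
      rw [hV, measureReal_def, eq_comm, ENNReal.toReal_eq_zero_iff] at h
      tauto
    have : S = 0 := by rw [hS, Measure.restrict_eq_zero.2 this, integral_zero_measure]
    rw [this]; positivity
  · have : V * S ≤ V * (2 * ediam K ^ 2 * G) := by linarith
    exact le_of_mul_le_mul_left this h

lemma edgeInt_symm (E : ℝ × ℝ → ℝ × ℝ) (q₀ q₁ : ℝ × ℝ) :
    edgeInt E q₁ q₀ = -edgeInt E q₀ q₁ := by
  unfold edgeInt
  rw [← intervalIntegral.integral_neg]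
  have h := intervalIntegral.integral_comp_sub_left (a := 0) (b := 1)
    (fun s : ℝ => -dot (E (q₀ + s • (q₁ - q₀))) (q₁ - q₀)) 1
  simp only [sub_self, sub_zero] at h
  rw [← h]
  refine intervalIntegral.integral_congr fun s _ => ?_
  have : q₁ + s • (q₀ - q₁) = q₀ + (1 - s) • (q₁ - q₀) := by
    rw [sub_smul, one_smul, smul_sub, smul_sub]; abel
  simp only [this, dot, Prod.fst_sub, Prod.snd_sub]
  ring

/-- Collapsed (Duffy) parametrization of the triangle `p, p + u, p + u + d` by the unit square. -/
def duffy (p u d z : ℝ × ℝ) : ℝ × ℝ := p + z.1 • (u + z.2 • d)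

/-- The derivative of `duffy`. -/
noncomputable def duffyDeriv (u d z : ℝ × ℝ) : ℝ × ℝ →L[ℝ] ℝ × ℝ :=
  (ContinuousLinearMap.fst ℝ ℝ ℝ).smulRight (u + z.2 • d)
    + (ContinuousLinearMap.snd ℝ ℝ ℝ).smulRight (z.1 • d)

/-- The planar cross product. -/
def cross (u d : ℝ × ℝ) : ℝ := u.1 * d.2 - u.2 * d.1

lemma continuous_duffy (p u d : ℝ × ℝ) : Continuous (duffy p u d) := by
  unfold duffy; fun_prop

lemma hasFDerivAt_duffy (p u d z : ℝ × ℝ) :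
    HasFDerivAt (duffy p u d) (duffyDeriv u d z) z := by
  have h1 : HasFDerivAt (fun z : ℝ × ℝ => z.1) (ContinuousLinearMap.fst ℝ ℝ ℝ) z :=
    hasFDerivAt_fst
  have h2 : HasFDerivAt (fun z : ℝ × ℝ => z.2) (ContinuousLinearMap.snd ℝ ℝ ℝ) z :=
    hasFDerivAt_snd
  refine ((h1.fun_smul ((h2.smul_const d).const_add u)).const_add p).congr_fderiv ?_
  ext <;> simp [duffyDeriv]

lemma det_duffyDeriv (u d z : ℝ × ℝ) : (duffyDeriv u d z).det = z.1 * cross u d := by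
  rw [ContinuousLinearMap.det, ← LinearMap.det_toMatrix (Module.Basis.finTwoProd ℝ),
    Matrix.det_fin_two]
  simp [LinearMap.toMatrix_apply, duffyDeriv, cross]
  ring

lemma injOn_duffy (p : ℝ × ℝ) {u d : ℝ × ℝ} (h : cross u d ≠ 0) :
    Set.InjOn (duffy p u d) (Set.Ioc 0 1 ×ˢ Set.Icc 0 1) := by
  rintro ⟨r, q⟩ ⟨hr, -⟩ ⟨r', q'⟩ - heq
  simp only [duffy, Prod.ext_iff, Prod.fst_add, Prod.snd_add, Prod.smul_fst, Prod.smul_snd,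
    smul_eq_mul] at heq
  obtain ⟨h1, h2⟩ := heq
  have e1 : r = r' := by
    refine mul_right_cancel₀ h ?_
    unfold cross
    linear_combination d.2 * h1 - d.1 * h2
  subst e1
  have hr0 : r ≠ 0 := hr.1.ne'
  have e2 : q = q' := by
    refine mul_left_cancel₀ hr0 (mul_right_cancel₀ h ?_)
    unfold cross
    linear_combination u.1 * h2 - u.2 * h1
  rw [e2]

lemma convexHull_eq_image_duffy (p : Fin 3 → ℝ × ℝ) :
    convexHull ℝ (Set.range p)
      = duffy (p 0) (p 1 - p 0) (p 2 - p 1) '' (Set.Icc 0 1 ×ˢ Set.Icc 0 1) := by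
  have hr : Set.range p = {p 0, p 1, p 2} := by
    ext x
    simp [Fin.exists_fin_succ, eq_comm]
  rw [hr, convexHull_insert (by simp), convexHull_pair, convexJoin_singleton_left]
  ext x
  simp only [Set.mem_iUnion, segment_eq_image', Set.mem_image, exists_prop, Set.mem_prod, duffy]
  constructor
  · rintro ⟨_, ⟨q, hq, rfl⟩, r, hr, rfl⟩
    exact ⟨(r, q), ⟨hr, hq⟩, by rw [add_sub_right_comm]⟩
  · rintro ⟨⟨r, q⟩, ⟨hr, hq⟩, rfl⟩
    exact ⟨_, ⟨q, hq, rfl⟩, r, hr, by rw [add_sub_right_comm]⟩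

lemma cross_ne_zero_of_affineIndependent {p : Fin 3 → ℝ × ℝ} (hp : AffineIndependent ℝ p) :
    cross (p 1 - p 0) (p 2 - p 1) ≠ 0 := by
  intro h
  have key : ∀ α β : ℝ, α • (p 1 - p 0) + β • (p 2 - p 1) = 0 → α = 0 ∧ β = 0 := by
    intro α β hαβ
    have := (affineIndependent_iff.1 hp) Finset.univ ![-α, α - β, β]
      (by simp [Fin.sum_univ_three]; ring) (by
        rw [← hαβ]
        simp [Fin.sum_univ_three]
        module)
    have h0 := this 0 (Finset.mem_univ _)
    have h2 := this 2 (Finset.mem_univ _)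
    simp at h0 h2
    exact ⟨h0, h2⟩
  unfold cross at h
  have k1 := key (p 2 - p 1).1 (-(p 1 - p 0).1)
    (by ext <;> simp at h ⊢ <;> linarith)
  have k2 := key (p 2 - p 1).2 (-(p 1 - p 0).2)
    (by ext <;> simp at h ⊢ <;> linarith)
  have k3 := key 1 0 (by
    ext
    · simpa using (neg_eq_zero.1 k1.2)
    · simpa using (neg_eq_zero.1 k2.2))
  exact one_ne_zero k3.1

lemma setIntegral_duffy {p u d : ℝ × ℝ} (h : cross u d ≠ 0) {K : Set (ℝ × ℝ)}
    (hK : K = duffy p u d '' (Set.Icc 0 1 ×ˢ Set.Icc 0 1)) {w : ℝ × ℝ → ℝ}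
    (hw : ContinuousOn w K) :
    ∫ x in K, w x
      = |cross u d| * ∫ r in (0 : ℝ)..1, ∫ q in (0 : ℝ)..1, r * w (duffy p u d (r, q)) := by
  set T : Set (ℝ × ℝ) := Set.Ioc 0 1 ×ˢ Set.Icc 0 1 with hT
  have hTm : MeasurableSet T := measurableSet_Ioc.prod measurableSet_Icc
  have hsub : T ⊆ Set.Icc 0 1 ×ˢ Set.Icc 0 1 :=
    Set.prod_mono Set.Ioc_subset_Icc_self subset_rfl
  have hae : K =ᵐ[volume] duffy p u d '' T := by
    refine Filter.EventuallyLE.antisymm ?_ (LE.le.eventuallyLE ?_)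
    · have : ∀ᵐ x : ℝ × ℝ, x ≠ p := by simp [ae_iff]
      filter_upwards [this] with x hx hxK
      rw [hK] at hxK
      obtain ⟨⟨r, q⟩, ⟨hr, hq⟩, rfl⟩ := hxK
      refine ⟨(r, q), ⟨⟨lt_of_le_of_ne hr.1 ?_, hr.2⟩, hq⟩, rfl⟩
      rintro rfl
      exact hx (by simp [duffy])
    · rw [hK]
      exact Set.image_mono hsub
  have hc : ContinuousOn (fun z : ℝ × ℝ => z.1 * w (duffy p u d z))
      (Set.Icc 0 1 ×ˢ Set.Icc 0 1) :=
    continuousOn_fst.mul (hw.comp (continuous_duffy p u d).continuousOn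
      fun z hz => hK ▸ Set.mem_image_of_mem _ hz)
  rw [setIntegral_congr_set hae, integral_image_eq_integral_abs_det_fderiv_smul volume hTm
    (fun z _ => (hasFDerivAt_duffy p u d z).hasFDerivWithinAt) (injOn_duffy p h)]
  have h1 : ∫ z in T, |(duffyDeriv u d z).det| • w (duffy p u d z)
      = ∫ z in T, |cross u d| * (z.1 * w (duffy p u d z)) := by
    refine setIntegral_congr_fun hTm fun z hz => ?_
    simp only [det_duffyDeriv, abs_mul, abs_of_pos hz.1.1, smul_eq_mul]
    ring
  rw [h1, integral_const_mul, Measure.volume_eq_prod, setIntegral_prod,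
    intervalIntegral.integral_of_le zero_le_one]
  · congr 1
    refine setIntegral_congr_fun measurableSet_Ioc fun r _ => ?_
    simp only
    rw [intervalIntegral.integral_of_le zero_le_one, integral_Icc_eq_integral_Ioc]
  · exact (hc.integrableOn_compact (isCompact_Icc.prod isCompact_Icc)).mono_set hsub

/-- Green's theorem on a triangle. -/
lemma cross_mul_integral_curl2 {p u d : ℝ × ℝ} {U : Set (ℝ × ℝ)} (hU : IsOpen U)
    (hKU : duffy p u d '' (Set.Icc 0 1 ×ˢ Set.Icc 0 1) ⊆ U) {E : ℝ × ℝ → ℝ × ℝ}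
    (hE : ContDiffOn ℝ 1 E U) :
    cross u d * ∫ r in (0 : ℝ)..1, ∫ q in (0 : ℝ)..1, r * curl2 E (duffy p u d (r, q))
      = edgeInt E p (p + u) + edgeInt E (p + u) (p + u + d) + edgeInt E (p + u + d) p := by
  have hmaps : Set.MapsTo (duffy p u d) (Set.Icc 0 1 ×ˢ Set.Icc 0 1) U :=
    fun z hz => hKU (Set.mem_image_of_mem _ hz)
  have hΦ := (continuous_duffy p u d).continuousOn (s := Set.Icc 0 1 ×ˢ Set.Icc 0 1)
  have hu : Set.uIcc (0 : ℝ) 1 = Set.Icc 0 1 := Set.uIcc_of_le zero_le_one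
  have hDc : ContinuousOn (fun z => fderiv ℝ E (duffy p u d z)) (Set.Icc 0 1 ×ˢ Set.Icc 0 1) :=
    (hE.continuousOn_fderiv_of_isOpen hU le_rfl).comp hΦ hmaps
  set A : ℝ × ℝ → ℝ × ℝ →L[ℝ] ℝ × ℝ := fun z =>
    (fderiv ℝ E (duffy p u d z)).comp (duffyDeriv u d z) with hA
  set E₁ : ℝ × ℝ → ℝ := fun z => (E (duffy p u d z)).1 with hE₁
  set E₂ : ℝ × ℝ → ℝ := fun z => (E (duffy p u d z)).2 with hE₂
  set A₁ : ℝ × ℝ → ℝ × ℝ →L[ℝ] ℝ := fun z => (ContinuousLinearMap.fst ℝ ℝ ℝ).comp (A z) with hA₁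
  set A₂ : ℝ × ℝ → ℝ × ℝ →L[ℝ] ℝ := fun z => (ContinuousLinearMap.snd ℝ ℝ ℝ).comp (A z) with hA₂
  have hder : ∀ z ∈ Set.Icc (0 : ℝ) 1 ×ˢ Set.Icc (0 : ℝ) 1,
      HasFDerivAt E₁ (A₁ z) z ∧ HasFDerivAt E₂ (A₂ z) z := by
    intro z hz
    have h1 : HasFDerivAt E (fderiv ℝ E (duffy p u d z)) (duffy p u d z) :=
      ((hE.differentiableOn one_ne_zero).differentiableAt
        (hU.mem_nhds (hmaps hz))).hasFDerivAt
    have h2 := h1.comp z (hasFDerivAt_duffy p u d z)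
    exact ⟨hasFDerivAt_fst.comp z h2, hasFDerivAt_snd.comp z h2⟩
  set f : ℝ × ℝ → ℝ := fun z => E₁ z * (z.1 * d.1) + E₂ z * (z.1 * d.2) with hf
  set g : ℝ × ℝ → ℝ := fun z =>
    -(E₁ z * (u.1 + z.2 * d.1) + E₂ z * (u.2 + z.2 * d.2)) with hg
  set f' : ℝ × ℝ → ℝ × ℝ →L[ℝ] ℝ := fun z =>
    (E₁ z • d.1 • ContinuousLinearMap.fst ℝ ℝ ℝ + (z.1 * d.1) • A₁ z)
      + (E₂ z • d.2 • ContinuousLinearMap.fst ℝ ℝ ℝ + (z.1 * d.2) • A₂ z) with hf'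
  set g' : ℝ × ℝ → ℝ × ℝ →L[ℝ] ℝ := fun z =>
    -((E₁ z • d.1 • ContinuousLinearMap.snd ℝ ℝ ℝ + (u.1 + z.2 * d.1) • A₁ z)
      + (E₂ z • d.2 • ContinuousLinearMap.snd ℝ ℝ ℝ + (u.2 + z.2 * d.2) • A₂ z)) with hg'
  have hfd : ∀ z ∈ Set.Icc (0 : ℝ) 1 ×ˢ Set.Icc (0 : ℝ) 1, HasFDerivAt f (f' z) z := by
    intro z hz
    have h1 : HasFDerivAt (fun z : ℝ × ℝ => z.1) (ContinuousLinearMap.fst ℝ ℝ ℝ) z :=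
      hasFDerivAt_fst
    exact ((hder z hz).1.fun_mul (h1.mul_const d.1)).fun_add
      ((hder z hz).2.fun_mul (h1.mul_const d.2))
  have hgd : ∀ z ∈ Set.Icc (0 : ℝ) 1 ×ˢ Set.Icc (0 : ℝ) 1, HasFDerivAt g (g' z) z := by
    intro z hz
    have h1 : HasFDerivAt (fun z : ℝ × ℝ => z.2) (ContinuousLinearMap.snd ℝ ℝ ℝ) z :=
      hasFDerivAt_snd
    exact (((hder z hz).1.fun_mul ((h1.mul_const d.1).const_add u.1)).fun_add
      ((hder z hz).2.fun_mul ((h1.mul_const d.2).const_add u.2))).fun_neg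
  have hcurl : ∀ z, f' z (1, 0) + g' z (0, 1)
      = cross u d * (z.1 * curl2 E (duffy p u d z)) := by
    intro z
    have hlin : ∀ v : ℝ × ℝ, fderiv ℝ E (duffy p u d z) v
        = v.1 • fderiv ℝ E (duffy p u d z) (1, 0)
          + v.2 • fderiv ℝ E (duffy p u d z) (0, 1) := by
      intro v
      rw [← map_smul, ← map_smul, ← map_add]
      congr 1
      ext <;> simp
    have hd1 : duffyDeriv u d z (1, 0) = u + z.2 • d := by simp [duffyDeriv]
    have hd2 : duffyDeriv u d z (0, 1) = z.1 • d := by simp [duffyDeriv]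
    simp only [hf', hg', hA₁, hA₂, hA, add_apply,
      neg_apply, smul_apply,
      ContinuousLinearMap.comp_apply, ContinuousLinearMap.coe_fst',
      ContinuousLinearMap.coe_snd', hd1, hd2]
    rw [hlin (u + z.2 • d), hlin (z.1 • d)]
    simp only [curl2, cross, Prod.fst_add, Prod.snd_add, Prod.smul_fst, Prod.smul_snd,
      smul_eq_mul]
    ring
  have hcc : ContinuousOn (fun z => cross u d * (z.1 * curl2 E (duffy p u d z)))
      (Set.Icc 0 1 ×ˢ Set.Icc 0 1) := by
    refine continuousOn_const.mul (continuousOn_fst.mul ?_)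
    exact (hDc.clm_apply continuousOn_const).snd.sub (hDc.clm_apply continuousOn_const).fst
  have hsub : Set.Ioo (min (0 : ℝ) 1) (max 0 1) ×ˢ Set.Ioo (min (0 : ℝ) 1) (max 0 1) \ ∅
      ⊆ Set.Icc 0 1 ×ˢ Set.Icc 0 1 := by
    simp only [zero_le_one, inf_of_le_left, sup_of_le_right, Set.sdiff_empty]
    exact Set.prod_mono Set.Ioo_subset_Icc_self Set.Ioo_subset_Icc_self
  have main := integral2_divergence_prod_of_hasFDerivAt_off_countable f g f' g' 0 0 1 1 ∅
    Set.countable_empty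
    (by rw [hu]; exact fun z hz => (hfd z hz).continuousAt.continuousWithinAt)
    (by rw [hu]; exact fun z hz => (hgd z hz).continuousAt.continuousWithinAt)
    (fun z hz => hfd z (hsub hz)) (fun z hz => hgd z (hsub hz))
    (by
      simp only [hcurl, hu]
      exact hcc.integrableOn_compact (isCompact_Icc.prod isCompact_Icc))
  simp only [hcurl, intervalIntegral.integral_const_mul] at main
  simp only [intervalIntegral.integral_const_mul]
  rw [main, edgeInt_symm E p (p + u + d)]
  have b1 : ∫ x in (0 : ℝ)..1, g (x, 1) = -edgeInt E p (p + u + d) := by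
    rw [edgeInt, ← intervalIntegral.integral_neg]
    refine intervalIntegral.integral_congr fun s _ => ?_
    simp [hg, hE₁, hE₂, dot, duffy, add_assoc]
  have b2 : ∫ x in (0 : ℝ)..1, g (x, 0) = -edgeInt E p (p + u) := by
    rw [edgeInt, ← intervalIntegral.integral_neg]
    refine intervalIntegral.integral_congr fun s _ => ?_
    simp [hg, hE₁, hE₂, dot, duffy]
  have b3 : ∫ y in (0 : ℝ)..1, f (1, y) = edgeInt E (p + u) (p + u + d) := by
    rw [edgeInt]
    refine intervalIntegral.integral_congr fun s _ => ?_
    simp [hf, hE₁, hE₂, dot, duffy, add_assoc]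
  have b4 : ∫ y in (0 : ℝ)..1, f (0, y) = 0 := by simp [hf]
  rw [b1, b2, b3, b4]
  ring

lemma contDiffOn_curl2 {E : ℝ × ℝ → ℝ × ℝ} {U : Set (ℝ × ℝ)} (hU : IsOpen U)
    (hE : ContDiffOn ℝ 2 E U) : ContDiffOn ℝ 1 (curl2 E) U := by
  have h : ContDiffOn ℝ 1 (fderiv ℝ E) U := hE.fderiv_of_isOpen hU (by norm_num)
  exact (h.clm_apply contDiffOn_const).snd.sub (h.clm_apply contDiffOn_const).fst

/-- The curl of a lowest-order Nédélec field is constant. -/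
lemma curl2_nedelec (a : ℝ × ℝ) (b : ℝ) (x : ℝ × ℝ) :
    curl2 (fun x => (a.1 - b * x.2, a.2 + b * x.1)) x = 2 * b := by
  have h1 : HasFDerivAt (fun z : ℝ × ℝ => z.1) (ContinuousLinearMap.fst ℝ ℝ ℝ) x :=
    hasFDerivAt_fst
  have h2 : HasFDerivAt (fun z : ℝ × ℝ => z.2) (ContinuousLinearMap.snd ℝ ℝ ℝ) x :=
    hasFDerivAt_snd
  have h := ((h2.const_mul b).const_sub a.1).prodMk ((h1.const_mul b).const_add a.2)
  rw [curl2, h.fderiv]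
  simp
  ring


/-- For every `γ ≥ 1` there is a constant `C` such that for every
nondegenerate triangle `K` with `h_K/ρ_K ≤ γ` and every C² vector field `E` on a
neighborhood of `K`, the curl of the Nédélec interpolation error satisfies
`‖curl(E − Π_K E)‖_{L²(K)} ≤ C h_K ‖curl E‖_{H¹(K)}`
(note `curl(Π_K E) = 2b` for `Π_K E = a + b(−y,x)ᵀ`). -/
theorem stmt_17 :
    ∀ γ : ℝ, 1 ≤ γ →
      ∃ C : ℝ,
        ∀ (p : Fin 3 → ℝ × ℝ), AffineIndependent ℝ p →
        ∀ (K : Set (ℝ × ℝ)), K = convexHull ℝ (Set.range p) →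
        ediam K ≤ γ * einrad K →
        ∀ (U : Set (ℝ × ℝ)), IsOpen U → K ⊆ U →
        ∀ (E : ℝ × ℝ → ℝ × ℝ), ContDiffOn ℝ 2 E U →
        ∀ (a : ℝ × ℝ) (b : ℝ) (PE : ℝ × ℝ → ℝ × ℝ),
          (∀ x : ℝ × ℝ, PE x = (a.1 - b * x.2, a.2 + b * x.1)) →
          (∀ i : Fin 3,
            edgeInt PE (p (i + 1)) (p (i + 2)) = edgeInt E (p (i + 1)) (p (i + 2))) →
        Real.sqrt (∫ x in K, (curl2 E x - 2 * b) ^ 2)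
          ≤ C * ediam K *
            Real.sqrt (∫ x in K,
              (curl2 E x) ^ 2 + (fderiv ℝ (curl2 E) x (1, 0)) ^ 2
                + (fderiv ℝ (curl2 E) x (0, 1)) ^ 2) := by
  intro γ _
  refine ⟨Real.sqrt 2, ?_⟩
  rintro p hp K hKp - U hU hKU E hE a b PE hPE hedge
  have hK : IsCompact K := hKp ▸ (Set.finite_range p).isCompact_convexHull ℝ
  have hconv : Convex ℝ K := hKp ▸ convex_convexHull ℝ _
  have hD := cross_ne_zero_of_affineIndependent hp
  have hKd := hKp.trans (convexHull_eq_image_duffy p)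
  have hw := contDiffOn_curl2 hU hE
  obtain rfl : PE = fun x => (a.1 - b * x.2, a.2 + b * x.1) := funext hPE
  have hPEd : ContDiff ℝ 1 fun x : ℝ × ℝ => (a.1 - b * x.2, a.2 + b * x.1) := by fun_prop
  have hmean : ∫ x in K, curl2 E x = ∫ _ in K, 2 * b := by
    have g1 := cross_mul_integral_curl2 hU (hKd ▸ hKU) (hE.of_le one_le_two)
    have g2 := cross_mul_integral_curl2 (p := p 0) (u := p 1 - p 0) (d := p 2 - p 1)
      isOpen_univ (Set.subset_univ _) hPEd.contDiffOn
    have e0 := hedge 0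
    have e1 := hedge 1
    have e2 := hedge 2
    simp only [Fin.isValue, zero_add, Fin.reduceAdd] at e0 e1 e2
    simp only [curl2_nedelec, add_sub_cancel] at g1 g2
    rw [e0, e1, e2, ← g1] at g2
    rw [setIntegral_duffy hD hKd (hw.continuousOn.mono hKU),
      setIntegral_duffy hD hKd continuousOn_const, mul_left_cancel₀ hD g2]
  have hwc : ContinuousOn (curl2 E) K := hw.continuousOn.mono hKU
  have hgc : ContinuousOn (gradSq (curl2 E)) K := (continuousOn_gradSq hU hw).mono hKU
  have hle : ∫ x in K, gradSq (curl2 E) x ≤ ∫ x in K,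
      (curl2 E x) ^ 2 + (fderiv ℝ (curl2 E) x (1, 0)) ^ 2
        + (fderiv ℝ (curl2 E) x (0, 1)) ^ 2 := by
    simp only [add_assoc]
    refine integral_mono (hgc.integrableOn_compact hK)
      (((hwc.pow 2).add hgc).integrableOn_compact hK) fun x => ?_
    exact le_add_of_nonneg_left (sq_nonneg _)
  have hdiam : 0 ≤ ediam K :=
    Real.sSup_nonneg (by rintro d ⟨u, -, v, -, rfl⟩; exact Real.sqrt_nonneg _)
  calc Real.sqrt (∫ x in K, (curl2 E x - 2 * b) ^ 2)
      ≤ Real.sqrt (2 * ediam K ^ 2 * ∫ x in K, gradSq (curl2 E) x) :=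
        Real.sqrt_le_sqrt (integral_sub_mean_sq_le hK hconv hU hKU hw hmean)
    _ = Real.sqrt 2 * ediam K * Real.sqrt (∫ x in K, gradSq (curl2 E) x) := by
        rw [Real.sqrt_mul (by positivity), Real.sqrt_mul zero_le_two, Real.sqrt_sq hdiam]
    _ ≤ _ := by gcongr
end

section
/- For every γ ≥ 1 there exists a constant C such that for every nondegenerate triangle K ⊂ ℝ² with shape-regularity ratio h_K/ρ_K ≤ γ, every continuously differentiable vector field E on a neighborhood of K, and every v ∈ N0⁺(K), the local quadrature error σ_K(Π_K E, v) := (|K|/3) Σ_{i=1}^{3} (Π_K E)(m_i) · v(m_i) − ∫_K (Π_K E)(x) · v(x) dx satisfies |σ_K(Π_K E, v)| ≤ C h_K ‖E‖_{H¹(K)} ‖v‖_{L²(K)}. -/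
open MeasureTheory

/-- Squared Euclidean norm on ℝ². -/
noncomputable def sq2 (u : ℝ × ℝ) : ℝ := u.1 ^ 2 + u.2 ^ 2

/-- The closed reference triangle with vertices `(0, 0)`, `(1, 0)` and `(0, 1)`. -/
def refTriangle : Set (ℝ × ℝ) := {z | 0 ≤ z.1 ∧ 0 ≤ z.2 ∧ z.1 + z.2 ≤ 1}

theorem isClosed_refTriangle : IsClosed refTriangle := by
  unfold refTriangle
  apply IsClosed.and (isClosed_le (by fun_prop) (by fun_prop))
  apply IsClosed.and (isClosed_le (by fun_prop) (by fun_prop))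
  exact isClosed_le (by fun_prop) (by fun_prop)

theorem isCompact_refTriangle : IsCompact refTriangle := by
  refine (isCompact_Icc (a := ((0, 0) : ℝ × ℝ)) (b := (1, 1))).of_isClosed_subset
    isClosed_refTriangle ?_
  rintro ⟨x, y⟩ ⟨h1, h2, h3⟩
  simp only at h1 h2 h3
  exact ⟨⟨h1, h2⟩, ⟨by simp only; linarith, by simp only; linarith⟩⟩

theorem integral_refTriangle_fst {f : ℝ × ℝ → ℝ} (hf : ContinuousOn f refTriangle) :
    ∫ z in refTriangle, f z = ∫ t in (0 : ℝ)..1, ∫ s in (0 : ℝ)..(1 - t), f (s, t) := by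
  have hm := isClosed_refTriangle.measurableSet
  have hi := (hf.integrableOn_compact isCompact_refTriangle (μ := volume)).integrable_indicator hm
  rw [← integral_indicator hm, Measure.volume_eq_prod, integral_prod_symm _ hi,
    intervalIntegral.integral_of_le zero_le_one, ← integral_Icc_eq_integral_Ioc,
    ← integral_indicator measurableSet_Icc]
  refine integral_congr_ae (Filter.Eventually.of_forall fun t => ?_)
  by_cases ht : t ∈ Set.Icc (0 : ℝ) 1
  · simp only [Set.indicator_of_mem ht]
    rw [intervalIntegral.integral_of_le (by linarith [ht.2]), ← integral_Icc_eq_integral_Ioc,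
      ← integral_indicator measurableSet_Icc]
    refine integral_congr_ae (Filter.Eventually.of_forall fun s => ?_)
    have : (s, t) ∈ refTriangle ↔ s ∈ Set.Icc 0 (1 - t) :=
      ⟨fun h => ⟨h.1, by linarith [h.2.2]⟩, fun h => ⟨h.1, ht.1, by simp only; linarith [h.2]⟩⟩
    by_cases hs : s ∈ Set.Icc 0 (1 - t)
    · simp only [Set.indicator_of_mem hs, Set.indicator_of_mem (this.2 hs)]
    · simp only [Set.indicator_of_notMem hs, Set.indicator_of_notMem (mt this.1 hs)]
  · simp only [Set.indicator_of_notMem ht]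
    refine integral_eq_zero_of_ae (Filter.Eventually.of_forall fun s => ?_)
    refine Set.indicator_of_notMem (fun h => ht ⟨h.2.1, ?_⟩) _
    have h1 := h.1
    have h2 := h.2.2
    simp only at h1 h2
    linarith

theorem integral_refTriangle_snd {f : ℝ × ℝ → ℝ} (hf : ContinuousOn f refTriangle) :
    ∫ z in refTriangle, f z = ∫ s in (0 : ℝ)..1, ∫ t in (0 : ℝ)..(1 - s), f (s, t) := by
  have hswap : Prod.swap ⁻¹' refTriangle = refTriangle := by
    ext ⟨x, y⟩
    simp only [refTriangle, Set.mem_preimage, Set.mem_ofPred_eq, Prod.swap_prod_mk, add_comm y x]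
    tauto
  have h1 : ∫ z in refTriangle, f z = ∫ z in refTriangle, f z.swap := by
    have := (Measure.measurePreserving_swap (μ := (volume : Measure ℝ))
      (ν := (volume : Measure ℝ))).setIntegral_preimage_emb
      MeasurableEquiv.prodComm.measurableEmbedding f refTriangle
    rw [hswap] at this
    exact this.symm
  rw [h1, integral_refTriangle_fst (f := fun z => f z.swap)]
  · rfl
  · refine hf.comp continuous_swap.continuousOn fun z hz => ?_
    rw [← hswap] at hz
    exact hz

theorem integral_refTriangle_quartic
    (c00 c10 c01 c20 c11 c02 c30 c21 c12 c03 c40 c31 c22 c13 c04 : ℝ) :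
    ∫ z in refTriangle, (c00 + c10 * z.1 + c01 * z.2 + c20 * z.1 ^ 2 + c11 * z.1 * z.2
      + c02 * z.2 ^ 2 + c30 * z.1 ^ 3 + c21 * z.1 ^ 2 * z.2 + c12 * z.1 * z.2 ^ 2 + c03 * z.2 ^ 3
      + c40 * z.1 ^ 4 + c31 * z.1 ^ 3 * z.2 + c22 * z.1 ^ 2 * z.2 ^ 2 + c13 * z.1 * z.2 ^ 3
      + c04 * z.2 ^ 4) =
    c00 / 2 + (c10 + c01) / 6 + (c20 + c02) / 12 + c11 / 24 + (c30 + c03) / 20 + (c21 + c12) / 60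
      + (c40 + c04) / 30 + (c31 + c13) / 120 + c22 / 180 := by
  rw [integral_refTriangle_fst (by fun_prop)]
  have inner : ∀ t : ℝ, ∫ s in (0 : ℝ)..(1 - t), (c00 + c10 * s + c01 * t + c20 * s ^ 2
      + c11 * s * t
      + c02 * t ^ 2 + c30 * s ^ 3 + c21 * s ^ 2 * t + c12 * s * t ^ 2 + c03 * t ^ 3
      + c40 * s ^ 4 + c31 * s ^ 3 * t + c22 * s ^ 2 * t ^ 2 + c13 * s * t ^ 3
      + c04 * t ^ 4) =
      (c00 + c01 * t + c02 * t ^ 2 + c03 * t ^ 3 + c04 * t ^ 4) * (1 - t)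
      + (c10 + c11 * t + c12 * t ^ 2 + c13 * t ^ 3) * ((1 - t) ^ 2 / 2)
      + (c20 + c21 * t + c22 * t ^ 2) * ((1 - t) ^ 3 / 3)
      + (c30 + c31 * t) * ((1 - t) ^ 4 / 4) + c40 * ((1 - t) ^ 5 / 5) := by
    intro t
    rw [intervalIntegral.integral_eq_sub_of_hasDerivAt (f := fun s =>
      (c00 + c01 * t + c02 * t ^ 2 + c03 * t ^ 3 + c04 * t ^ 4) * s
      + (c10 + c11 * t + c12 * t ^ 2 + c13 * t ^ 3) * (s ^ 2 / 2)
      + (c20 + c21 * t + c22 * t ^ 2) * (s ^ 3 / 3)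
      + (c30 + c31 * t) * (s ^ 4 / 4) + c40 * (s ^ 5 / 5))]
    · ring
    · intro s _
      have h := (((((hasDerivAt_id s).const_mul
          (c00 + c01 * t + c02 * t ^ 2 + c03 * t ^ 3 + c04 * t ^ 4)).add
        (((hasDerivAt_pow 2 s).div_const 2).const_mul
          (c10 + c11 * t + c12 * t ^ 2 + c13 * t ^ 3))).add
        (((hasDerivAt_pow 3 s).div_const 3).const_mul (c20 + c21 * t + c22 * t ^ 2))).add
        (((hasDerivAt_pow 4 s).div_const 4).const_mul (c30 + c31 * t))).add
        (((hasDerivAt_pow 5 s).div_const 5).const_mul c40)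
      refine h.congr_deriv ?_
      push_cast
      ring
    · exact Continuous.intervalIntegrable (by fun_prop) _ _
  simp only [inner]
  rw [intervalIntegral.integral_eq_sub_of_hasDerivAt (f := fun t =>
      c00 * (t - t ^ 2 / 2) + c01 * (t ^ 2 / 2 - t ^ 3 / 3) + c02 * (t ^ 3 / 3 - t ^ 4 / 4)
      + c03 * (t ^ 4 / 4 - t ^ 5 / 5) + c04 * (t ^ 5 / 5 - t ^ 6 / 6)
      + c10 * (-(1 - t) ^ 3 / 6)
      + c11 * (t ^ 2 / 4 - t ^ 3 / 3 + t ^ 4 / 8)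
      + c12 * (t ^ 3 / 6 - t ^ 4 / 4 + t ^ 5 / 10)
      + c13 * (t ^ 4 / 8 - t ^ 5 / 5 + t ^ 6 / 12)
      + c20 * (-(1 - t) ^ 4 / 12)
      + c21 * (-(1 - t) ^ 4 / 12 + (1 - t) ^ 5 / 15)
      + c22 * (-(1 - t) ^ 4 / 12 + (1 - t) ^ 5 * 2 / 15 - (1 - t) ^ 6 / 18)
      + c30 * (-(1 - t) ^ 5 / 20)
      + c31 * (-(1 - t) ^ 5 / 20 + (1 - t) ^ 6 / 24)
      + c40 * (-(1 - t) ^ 6 / 30))]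
  · norm_num
    ring
  · intro t _
    have p (n : ℕ) := hasDerivAt_pow n t
    have r (n : ℕ) : HasDerivAt (fun t : ℝ => (1 - t) ^ n) (-(n * (1 - t) ^ (n - 1))) t := by
      have := ((hasDerivAt_id t).const_sub 1).pow n
      refine this.congr_deriv ?_
      simp
    have h := ((((((((((((((((hasDerivAt_id t).sub ((p 2).div_const 2)).const_mul c00).add
      ((((p 2).div_const 2).sub ((p 3).div_const 3)).const_mul c01)).add
      ((((p 3).div_const 3).sub ((p 4).div_const 4)).const_mul c02)).add
      ((((p 4).div_const 4).sub ((p 5).div_const 5)).const_mul c03)).add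
      ((((p 5).div_const 5).sub ((p 6).div_const 6)).const_mul c04)).add
      (((r 3).neg.div_const 6).const_mul c10)).add
      (((((p 2).div_const 4).sub ((p 3).div_const 3)).add ((p 4).div_const 8)).const_mul c11)).add
      (((((p 3).div_const 6).sub ((p 4).div_const 4)).add ((p 5).div_const 10)).const_mul c12)).add
      (((((p 4).div_const 8).sub ((p 5).div_const 5)).add ((p 6).div_const 12)).const_mul c13)).add
      (((r 4).neg.div_const 12).const_mul c20)).add
      ((((r 4).neg.div_const 12).add ((r 5).div_const 15)).const_mul c21)).add
      (((((r 4).neg.div_const 12).add (((r 5).mul_const 2).div_const 15)).sub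
        ((r 6).div_const 18)).const_mul c22)).add
      (((r 5).neg.div_const 20).const_mul c30)).add
      ((((r 5).neg.div_const 20).add ((r 6).div_const 24)).const_mul c31)).add
      (((r 6).neg.div_const 30).const_mul c40)
    refine h.congr_deriv ?_
    push_cast
    ring
  · exact Continuous.intervalIntegrable (by fun_prop) _ _

theorem quadratic_coeff_sq_le_integral (c0 c1 c2 c3 c4 c5 : ℝ) :
    let q : ℝ × ℝ → ℝ := fun z => c0 + c1 * z.1 + c2 * z.2 + c3 * (z.1 * z.2)
      + c4 * (z.2 * (1 - z.1 - z.2)) + c5 * ((1 - z.1 - z.2) * z.1)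
    c3 ^ 2 ≤ 1080 * ∫ z in refTriangle, q z ^ 2 ∧ c4 ^ 2 ≤ 1080 * ∫ z in refTriangle, q z ^ 2 ∧
      c5 ^ 2 ≤ 1080 * ∫ z in refTriangle, q z ^ 2 := by
  intro q
  have key : ∫ z in refTriangle, q z ^ 2 =
      1/2*(c0 + (1/3)*c1 + (1/3)*c2 + (1/12)*c4 + (1/12)*c5 + (1/12)*c3)^2
      + 1/36*(c1 + (-1/2)*c2 + (-1/5)*c4 + (1/10)*c5 + (1/10)*c3)^2
      + 1/48*(c2 + (-1/5)*c5 + (1/5)*c3)^2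
      + 7/7200*(c4 + (-1/7)*c5 + (-1/7)*c3)^2
      + 1/1050*(c5 + (-1/6)*c3)^2 + 1/1080*c3^2 := by
    let a := c1 + c5
    let b := c2 + c4
    let e := c3 - c4 - c5
    have h := integral_refTriangle_quartic (c0 ^ 2) (2 * c0 * a) (2 * c0 * b)
      (a ^ 2 - 2 * c0 * c5) (2 * a * b + 2 * c0 * e) (b ^ 2 - 2 * c0 * c4)
      (-2 * a * c5) (2 * a * e - 2 * b * c5) (2 * b * e - 2 * a * c4) (-2 * b * c4)
      (c5 ^ 2) (-2 * c5 * e) (e ^ 2 + 2 * c4 * c5) (-2 * c4 * e) (c4 ^ 2)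
    refine Eq.trans (integral_congr_ae (Filter.Eventually.of_forall fun z => ?_)) (h.trans ?_)
    · simp only [q, a, b, e]; ring
    · simp only [a, b, e]; ring
  have k4 : ∫ z in refTriangle, q z ^ 2 =
      1/2*(c0 + (1/3)*c1 + (1/3)*c2 + (1/12)*c3 + (1/12)*c5 + (1/12)*c4)^2
      + 1/36*(c1 + (-1/2)*c2 + (1/10)*c3 + (1/10)*c5 + (-1/5)*c4)^2
      + 1/48*(c2 + (1/5)*c3 + (-1/5)*c5)^2
      + 7/7200*(c3 + (-1/7)*c5 + (-1/7)*c4)^2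
      + 1/1050*(c5 + (-1/6)*c4)^2 + 1/1080*c4^2 := by rw [key]; ring
  have k5 : ∫ z in refTriangle, q z ^ 2 =
      1/2*(c0 + (1/3)*c1 + (1/3)*c2 + (1/12)*c3 + (1/12)*c4 + (1/12)*c5)^2
      + 1/36*(c1 + (-1/2)*c2 + (1/10)*c3 + (-1/5)*c4 + (1/10)*c5)^2
      + 1/48*(c2 + (1/5)*c3 + (-1/5)*c5)^2
      + 7/7200*(c3 + (-1/7)*c4 + (-1/7)*c5)^2
      + 1/1050*(c4 + (-1/6)*c5)^2 + 1/1080*c5^2 := by rw [key]; ring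
  refine ⟨?_, ?_, ?_⟩
  · rw [key]
    linarith [sq_nonneg (c0 + (1/3)*c1 + (1/3)*c2 + (1/12)*c4 + (1/12)*c5 + (1/12)*c3),
      sq_nonneg (c1 + (-1/2)*c2 + (-1/5)*c4 + (1/10)*c5 + (1/10)*c3),
      sq_nonneg (c2 + (-1/5)*c5 + (1/5)*c3),
      sq_nonneg (c4 + (-1/7)*c5 + (-1/7)*c3),
      sq_nonneg (c5 + (-1/6)*c3)]
  · rw [k4]
    linarith [sq_nonneg (c0 + (1/3)*c1 + (1/3)*c2 + (1/12)*c3 + (1/12)*c5 + (1/12)*c4),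
      sq_nonneg (c1 + (-1/2)*c2 + (1/10)*c3 + (1/10)*c5 + (-1/5)*c4),
      sq_nonneg (c2 + (1/5)*c3 + (-1/5)*c5),
      sq_nonneg (c3 + (-1/7)*c5 + (-1/7)*c4),
      sq_nonneg (c5 + (-1/6)*c4)]
  · rw [k5]
    linarith [sq_nonneg (c0 + (1/3)*c1 + (1/3)*c2 + (1/12)*c3 + (1/12)*c4 + (1/12)*c5),
      sq_nonneg (c1 + (-1/2)*c2 + (1/10)*c3 + (-1/5)*c4 + (1/10)*c5),
      sq_nonneg (c2 + (1/5)*c3 + (-1/5)*c5),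
      sq_nonneg (c3 + (-1/7)*c4 + (-1/7)*c5),
      sq_nonneg (c4 + (-1/6)*c5)]

theorem integral_refTriangle_deriv_fst {f f' : ℝ × ℝ → ℝ}
    (hd : ∀ z ∈ refTriangle, HasDerivAt (fun s => f (s, z.2)) (f' z) z.1)
    (hc : ContinuousOn f' refTriangle) :
    ∫ z in refTriangle, f' z = ∫ t in (0 : ℝ)..1, (f (1 - t, t) - f (0, t)) := by
  rw [integral_refTriangle_fst hc]
  refine intervalIntegral.integral_congr fun t ht => ?_
  rw [Set.uIcc_of_le zero_le_one] at ht
  have hmem : ∀ s ∈ Set.uIcc 0 (1 - t), (s, t) ∈ refTriangle := by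
    intro s hs
    rw [Set.uIcc_of_le (by linarith [ht.2])] at hs
    exact ⟨hs.1, ht.1, by simp only; linarith [hs.2]⟩
  refine intervalIntegral.integral_eq_sub_of_hasDerivAt (f := fun s => f (s, t))
    (fun s hs => hd _ (hmem s hs)) (ContinuousOn.intervalIntegrable ?_)
  exact hc.comp (by fun_prop) hmem

theorem integral_refTriangle_deriv_snd {f f' : ℝ × ℝ → ℝ}
    (hd : ∀ z ∈ refTriangle, HasDerivAt (fun t => f (z.1, t)) (f' z) z.2)
    (hc : ContinuousOn f' refTriangle) :
    ∫ z in refTriangle, f' z = ∫ s in (0 : ℝ)..1, (f (s, 1 - s) - f (s, 0)) := by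
  rw [integral_refTriangle_snd hc]
  refine intervalIntegral.integral_congr fun s hs => ?_
  rw [Set.uIcc_of_le zero_le_one] at hs
  have hmem : ∀ t ∈ Set.uIcc 0 (1 - s), (s, t) ∈ refTriangle := by
    intro t ht
    rw [Set.uIcc_of_le (by linarith [hs.2])] at ht
    exact ⟨hs.1, ht.1, by simp only; linarith [ht.2]⟩
  refine intervalIntegral.integral_eq_sub_of_hasDerivAt (f := fun t => f (s, t))
    (fun t ht => hd _ (hmem t ht)) (ContinuousOn.intervalIntegrable ?_)
  exact hc.comp (by fun_prop) hmem

/-- Affine parametrization of the triangle with vertices `r`, `r + d`, `r + e`. -/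
def triangleMap (r d e : ℝ × ℝ) (z : ℝ × ℝ) : ℝ × ℝ := r + z.1 • d + z.2 • e

theorem convexHull_range_eq_image_triangleMap (p : Fin 3 → ℝ × ℝ) :
    convexHull ℝ (Set.range p) = triangleMap (p 2) (p 0 - p 2) (p 1 - p 2) '' refTriangle := by
  apply Set.Subset.antisymm
  · apply convexHull_min
    · rintro _ ⟨i, rfl⟩
      fin_cases i
      · exact ⟨(1, 0), by simp [refTriangle], by simp [triangleMap]⟩
      · exact ⟨(0, 1), by simp [refTriangle], by simp [triangleMap]⟩
      · exact ⟨(0, 0), by simp [refTriangle], by simp [triangleMap]⟩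
    · rintro _ ⟨x, ⟨hx1, hx2, hx3⟩, rfl⟩ _ ⟨y, ⟨hy1, hy2, hy3⟩, rfl⟩ a b ha hb hab
      refine ⟨a • x + b • y, ⟨?_, ?_, ?_⟩, ?_⟩
      · simp only [Prod.fst_add, Prod.smul_fst, smul_eq_mul]; positivity
      · simp only [Prod.snd_add, Prod.smul_snd, smul_eq_mul]; positivity
      · simp only [Prod.fst_add, Prod.smul_fst, Prod.snd_add, Prod.smul_snd, smul_eq_mul]
        nlinarith
      · obtain rfl : b = 1 - a := by linarith
        ext <;> simp [triangleMap] <;> ring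
  · rintro _ ⟨z, ⟨h1, h2, h3⟩, rfl⟩
    have h := (convex_convexHull ℝ (Set.range p)).sum_mem (t := Finset.univ)
      (w := ![z.1, z.2, 1 - z.1 - z.2]) (z := p)
      (by intro i _; fin_cases i <;> simp <;> linarith) (by simp [Fin.sum_univ_three])
      (fun i _ => subset_convexHull ℝ _ ⟨i, rfl⟩)
    convert h using 1
    simp only [triangleMap, Fin.sum_univ_three]
    ext <;> simp <;> ring

theorem setIntegral_triangleMap_image {r d e : ℝ × ℝ} (hD : d.1 * e.2 - d.2 * e.1 ≠ 0)
    (f : ℝ × ℝ → ℝ) :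
    ∫ x in triangleMap r d e '' refTriangle, f x =
      |d.1 * e.2 - d.2 * e.1| * ∫ z in refTriangle, f (triangleMap r d e z) := by
  let L : ℝ × ℝ →L[ℝ] ℝ × ℝ := LinearMap.toContinuousLinearMap
    (Matrix.toLin (.finTwoProd ℝ) (.finTwoProd ℝ) !![d.1, e.1; d.2, e.2])
  have hL : ∀ z, L z = z.1 • d + z.2 • e := by
    intro z
    simp only [L, Matrix.toLin_finTwoProd_toContinuousLinearMap]
    ext <;> simp <;> ring
  have hdet : L.det = d.1 * e.2 - d.2 * e.1 := by
    simp only [L, LinearMap.det_toContinuousLinearMap, LinearMap.det_toLin, Matrix.det_fin_two_of]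
    ring
  have hF : triangleMap r d e = fun z => r + L z := by
    funext z; rw [hL, triangleMap, add_assoc]
  have hder : ∀ z ∈ refTriangle, HasFDerivWithinAt (triangleMap r d e) L refTriangle z := by
    intro z _
    rw [hF]
    exact (L.hasFDerivAt.const_add r).hasFDerivWithinAt
  have hinj : Set.InjOn (triangleMap r d e) refTriangle := by
    rintro ⟨s, t⟩ _ ⟨s', t'⟩ _ h
    simp only [triangleMap, Prod.ext_iff, Prod.fst_add, Prod.snd_add, Prod.smul_fst,
      Prod.smul_snd, smul_eq_mul] at h
    obtain ⟨ha, hb⟩ := h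
    have h1 : (s - s') * (d.1 * e.2 - d.2 * e.1) = 0 := by linear_combination e.2 * ha - e.1 * hb
    have h2 : (t - t') * (d.1 * e.2 - d.2 * e.1) = 0 := by linear_combination d.1 * hb - d.2 * ha
    simp only [mul_eq_zero, hD, or_false, sub_eq_zero] at h1 h2
    rw [h1, h2]
  rw [integral_image_eq_integral_abs_det_fderiv_smul volume isClosed_refTriangle.measurableSet
    hder hinj, hdet]
  simp only [smul_eq_mul]
  exact integral_const_mul _ _

theorem volume_triangleMap_image {r d e : ℝ × ℝ} (hD : d.1 * e.2 - d.2 * e.1 ≠ 0) :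
    (volume (triangleMap r d e '' refTriangle)).toReal = |d.1 * e.2 - d.2 * e.1| / 2 := by
  have h := setIntegral_triangleMap_image (r := r) hD fun _ => 1
  have h1 := integral_refTriangle_quartic 1 0 0 0 0 0 0 0 0 0 0 0 0 0 0
  norm_num at h1
  simp only [setIntegral_const, smul_eq_mul, mul_one] at h
  rw [h1] at h
  exact h.trans (by ring)

theorem sq_setIntegral_le {K : Set (ℝ × ℝ)} (hK : IsCompact K) {f : ℝ × ℝ → ℝ}
    (hf : ContinuousOn f K) (h0 : 0 < (volume K).toReal) :
    (∫ x in K, f x) ^ 2 ≤ (volume K).toReal * ∫ x in K, f x ^ 2 := by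
  set V := (volume K).toReal
  set I := ∫ x in K, f x
  have hi : IntegrableOn f K volume := hf.integrableOn_compact hK
  have hi2 : IntegrableOn (fun x => f x ^ 2) K volume := (hf.pow 2).integrableOn_compact hK
  have hic : IntegrableOn (fun _ => (I / V) ^ 2) K (volume : Measure (ℝ × ℝ)) :=
    continuousOn_const.integrableOn_compact hK
  have h : 0 ≤ ∫ x in K, (f x - I / V) ^ 2 := integral_nonneg fun x => sq_nonneg _
  have e : ∫ x in K, (f x - I / V) ^ 2 = ∫ x in K, (f x ^ 2 - 2 * (I / V) * f x + (I / V) ^ 2) :=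
    integral_congr_ae (Filter.Eventually.of_forall fun x => by simp only; ring)
  have hi3 : IntegrableOn (fun x => f x ^ 2 - 2 * (I / V) * f x) K volume :=
    hi2.sub (hi.const_mul _)
  rw [e, integral_add hi3 hic, integral_sub hi2 (hi.const_mul _),
    integral_const_mul, setIntegral_const, smul_eq_mul] at h
  change 0 ≤ _ - 2 * (I / V) * I + V * (I / V) ^ 2 at h
  have : 2 * (I / V) * I - V * (I / V) ^ 2 = I ^ 2 / V := by field_simp; ring
  have h3 : I ^ 2 / V ≤ ∫ x in K, f x ^ 2 := by linarith
  rwa [div_le_iff₀' h0] at h3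

theorem ediam_nonneg (K : Set (ℝ × ℝ)) : 0 ≤ ediam K :=
  Real.sSup_nonneg (by rintro _ ⟨u, _, v, _, rfl⟩; positivity)

theorem dot_sub_self_le_ediam_sq {K : Set (ℝ × ℝ)} (hK : IsCompact K) {u v : ℝ × ℝ}
    (hu : u ∈ K) (hv : v ∈ K) : dot (u - v) (u - v) ≤ ediam K ^ 2 := by
  have hb : BddAbove {d : ℝ | ∃ u ∈ K, ∃ v ∈ K, d = Real.sqrt (dot (u - v) (u - v))} := by
    have h := ((hK.prod hK).image (f := fun w : (ℝ × ℝ) × (ℝ × ℝ) =>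
      Real.sqrt (dot (w.1 - w.2) (w.1 - w.2))) (by unfold dot; fun_prop)).bddAbove
    refine h.mono ?_
    rintro _ ⟨u, hu, v, hv, rfl⟩
    exact ⟨(u, v), ⟨hu, hv⟩, rfl⟩
  exact Real.sqrt_le_left (ediam_nonneg K) |>.1 (le_csSup hb ⟨u, hu, v, hv, rfl⟩)

theorem einrad_sq_le_volume {K : Set (ℝ × ℝ)} (hK : IsCompact K) :
    einrad K ^ 2 ≤ (volume K).toReal := by
  have h0 : 0 ≤ einrad K := Real.sSup_nonneg fun r hr => hr.1
  rw [← Real.le_sqrt h0 ENNReal.toReal_nonneg]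
  refine Real.sSup_le ?_ (Real.sqrt_nonneg _)
  rintro r ⟨hr, x, hx⟩
  rw [Real.le_sqrt hr ENNReal.toReal_nonneg]
  have hbox : Set.Icc (x.1 - r / 2) (x.1 + r / 2) ×ˢ Set.Icc (x.2 - r / 2) (x.2 + r / 2) ⊆ K := by
    rintro ⟨y1, y2⟩ ⟨⟨h1, h2⟩, ⟨h3, h4⟩⟩
    refine hx ?_
    simp only at h1 h2 h3 h4
    refine Real.sqrt_le_iff.2 ⟨hr, ?_⟩
    simp only [dot, Prod.fst_sub, Prod.snd_sub]
    nlinarith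
  have hv := ENNReal.toReal_mono hK.measure_lt_top.ne (measure_mono (μ := volume) hbox)
  rw [Measure.volume_eq_prod, Measure.prod_prod, Real.volume_Icc, Real.volume_Icc,
    ENNReal.toReal_mul, ENNReal.toReal_ofReal (by linarith),
    ENNReal.toReal_ofReal (by linarith)] at hv
  calc r ^ 2 = (x.1 + r / 2 - (x.1 - r / 2)) * (x.2 + r / 2 - (x.2 - r / 2)) := by ring
    _ ≤ _ := hv

theorem sum_edgeInt_eq_integral_curl {U : Set (ℝ × ℝ)} (hU : IsOpen U) {E : ℝ × ℝ → ℝ × ℝ}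
    (hE : ContDiffOn ℝ 1 E U) {r d e : ℝ × ℝ}
    (hK : ∀ z ∈ refTriangle, triangleMap r d e z ∈ U) :
    edgeInt E (r + e) r + edgeInt E r (r + d) + edgeInt E (r + d) (r + e) =
      (d.1 * e.2 - d.2 * e.1) * ∫ z in refTriangle,
        ((fderiv ℝ E (triangleMap r d e z) (1, 0)).2
          - (fderiv ℝ E (triangleMap r d e z) (0, 1)).1) := by
  set F := triangleMap r d e with hF
  have hFc : Continuous F := by rw [hF]; unfold triangleMap; fun_prop
  have hEF : ContinuousOn (fun z => E (F z)) refTriangle :=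
    hE.continuousOn.comp hFc.continuousOn hK
  have hdE : ContinuousOn (fun z => fderiv ℝ E (F z)) refTriangle :=
    (hE.continuousOn_fderiv_of_isOpen hU le_rfl).comp hFc.continuousOn hK
  have hder : ∀ z ∈ refTriangle, HasFDerivAt E (fderiv ℝ E (F z)) (F z) := fun z hz =>
    ((hE.differentiableOn one_ne_zero).differentiableAt (hU.mem_nhds (hK z hz))).hasFDerivAt
  let A : ℝ × ℝ → ℝ := fun z => dot (E (F z)) d
  let B : ℝ × ℝ → ℝ := fun z => dot (E (F z)) e
  have hAc : ContinuousOn A refTriangle :=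
    (hEF.fst.mul continuousOn_const).add (hEF.snd.mul continuousOn_const)
  have hBc : ContinuousOn B refTriangle :=
    (hEF.fst.mul continuousOn_const).add (hEF.snd.mul continuousOn_const)
  have hdot : ∀ (w : ℝ × ℝ) {f : ℝ → ℝ × ℝ} {f' : ℝ × ℝ} {x : ℝ}, HasDerivAt f f' x →
      HasDerivAt (fun s => dot (f s) w) (dot f' w) x := by
    intro w f f' x h
    let L : ℝ × ℝ →L[ℝ] ℝ :=
      w.1 • ContinuousLinearMap.fst ℝ ℝ ℝ + w.2 • ContinuousLinearMap.snd ℝ ℝ ℝ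
    have hL : ∀ u, L u = dot u w := fun u => by simp [L, dot, mul_comm]
    have := L.hasFDerivAt.comp_hasDerivAt x h
    simpa only [Function.comp_def, hL] using this
  have hB : ∫ z in refTriangle, dot (fderiv ℝ E (F z) d) e =
      ∫ t in (0 : ℝ)..1, (B (1 - t, t) - B (0, t)) := by
    refine integral_refTriangle_deriv_fst (fun z hz => ?_) (by unfold dot; fun_prop)
    have h1 : HasDerivAt (fun s => F (s, z.2)) d z.1 := by
      have := (((hasDerivAt_id z.1).smul_const d).const_add r).add_const (z.2 • e)
      simpa [hF, triangleMap] using this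
    exact hdot e ((hder z hz).comp_hasDerivAt z.1 h1)
  have hA : ∫ z in refTriangle, dot (fderiv ℝ E (F z) e) d =
      ∫ s in (0 : ℝ)..1, (A (s, 1 - s) - A (s, 0)) := by
    refine integral_refTriangle_deriv_snd (fun z hz => ?_) (by unfold dot; fun_prop)
    have h1 : HasDerivAt (fun t => F (z.1, t)) e z.2 := by
      have := ((hasDerivAt_id z.2).smul_const e).const_add (r + z.1 • d)
      simpa [hF, triangleMap] using this
    exact hdot d ((hder z hz).comp_hasDerivAt z.2 h1)
  have hcurl : (d.1 * e.2 - d.2 * e.1) * ∫ z in refTriangle,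
      ((fderiv ℝ E (F z) (1, 0)).2 - (fderiv ℝ E (F z) (0, 1)).1) =
      (∫ z in refTriangle, dot (fderiv ℝ E (F z) d) e)
        - ∫ z in refTriangle, dot (fderiv ℝ E (F z) e) d := by
    rw [← integral_const_mul, ← integral_sub]
    · refine integral_congr_ae (Filter.Eventually.of_forall fun z => ?_)
      have hlin : ∀ w : ℝ × ℝ, fderiv ℝ E (F z) w =
          w.1 • fderiv ℝ E (F z) (1, 0) + w.2 • fderiv ℝ E (F z) (0, 1) := by
        intro w
        rw [← map_smul, ← map_smul, ← map_add]
        simp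
      simp only [hlin d, hlin e, dot, Prod.fst_add, Prod.snd_add, Prod.smul_fst, Prod.smul_snd,
        smul_eq_mul]
      ring
    · exact ContinuousOn.integrableOn_compact isCompact_refTriangle (by unfold dot; fun_prop)
    · exact ContinuousOn.integrableOn_compact isCompact_refTriangle (by unfold dot; fun_prop)
  have hint : ∀ {f : ℝ × ℝ → ℝ} {c : ℝ → ℝ × ℝ}, ContinuousOn f refTriangle → Continuous c →
      (∀ s ∈ Set.Icc (0 : ℝ) 1, c s ∈ refTriangle) →
      IntervalIntegrable (fun s => f (c s)) volume 0 1 := by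
    intro f c hf hc hm
    refine ContinuousOn.intervalIntegrable (hf.comp hc.continuousOn ?_)
    rwa [Set.uIcc_of_le zero_le_one]
  have m1 : ∀ s ∈ Set.Icc (0 : ℝ) 1, (s, (0 : ℝ)) ∈ refTriangle := fun s hs =>
    ⟨hs.1, le_rfl, by simp only; linarith [hs.2]⟩
  have m2 : ∀ s ∈ Set.Icc (0 : ℝ) 1, ((0 : ℝ), s) ∈ refTriangle := fun s hs =>
    ⟨le_rfl, hs.1, by simp only; linarith [hs.2]⟩
  have m3 : ∀ s ∈ Set.Icc (0 : ℝ) 1, (s, 1 - s) ∈ refTriangle := fun s hs =>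
    ⟨hs.1, by simp only; linarith [hs.2], by simp⟩
  have m4 : ∀ s ∈ Set.Icc (0 : ℝ) 1, (1 - s, s) ∈ refTriangle := fun s hs =>
    ⟨by simp only; linarith [hs.2], hs.1, by simp⟩
  have e1 : edgeInt E (r + e) r = -∫ s in (0 : ℝ)..1, B (0, s) := by
    have h := intervalIntegral.integral_comp_sub_left (a := 0) (b := 1) (fun s => B (0, s)) 1
    rw [sub_self, sub_zero] at h
    rw [← h, ← intervalIntegral.integral_neg, edgeInt]
    refine intervalIntegral.integral_congr fun s _ => ?_
    have : r + e + s • (r - (r + e)) = F (0, 1 - s) := by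
      ext <;> simp [hF, triangleMap] <;> ring
    simp only [this, B, dot, Prod.fst_sub, Prod.snd_sub, Prod.fst_add, Prod.snd_add]
    ring
  have e2 : edgeInt E r (r + d) = ∫ s in (0 : ℝ)..1, A (s, 0) := by
    refine intervalIntegral.integral_congr fun s _ => ?_
    have : r + s • (r + d - r) = F (s, 0) := by
      ext <;> simp [hF, triangleMap]
    simp only [A, ← this, add_sub_cancel_left]
  have e3 : edgeInt E (r + d) (r + e) =
      (∫ s in (0 : ℝ)..1, B (1 - s, s)) - ∫ s in (0 : ℝ)..1, A (s, 1 - s) := by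
    have h := intervalIntegral.integral_comp_sub_left (a := 0) (b := 1) (fun s => A (s, 1 - s)) 1
    rw [sub_self, sub_zero] at h
    simp only [sub_sub_cancel] at h
    rw [← h, ← intervalIntegral.integral_sub (hint hBc (by fun_prop) m4)
      (hint hAc (by fun_prop) m4), edgeInt]
    refine intervalIntegral.integral_congr fun s _ => ?_
    have : r + d + s • (r + e - (r + d)) = F (1 - s, s) := by
      ext <;> simp [hF, triangleMap] <;> ring
    simp only [this, A, B, dot, Prod.fst_sub, Prod.snd_sub, Prod.fst_add, Prod.snd_add]
    ring
  rw [hcurl, hA, hB, e1, e2, e3,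
    intervalIntegral.integral_sub (hint hBc (by fun_prop) m4) (hint hBc (by fun_prop) m2),
    intervalIntegral.integral_sub (hint hAc (by fun_prop) m3) (hint hAc (by fun_prop) m1)]
  ring

theorem midpoint_quadrature_defect_refTriangle (a0 b0 c0 a1 b1 c1 a2 b2 c2 u0 u1 u2 k0 k1 k2 : ℝ)
    {f : ℝ × ℝ → ℝ} (hf : ∀ z, f z =
      u0 * (z.1 * (a1 + b1 * z.1 + c1 * z.2) - z.2 * (a0 + b0 * z.1 + c0 * z.2))
      + k0 * (z.1 * z.2 * (a2 + b2 * z.1 + c2 * z.2))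
      + u1 * (z.2 * (a2 + b2 * z.1 + c2 * z.2) - (1 - z.1 - z.2) * (a1 + b1 * z.1 + c1 * z.2))
      + k1 * (z.2 * (1 - z.1 - z.2) * (a0 + b0 * z.1 + c0 * z.2))
      + u2 * ((1 - z.1 - z.2) * (a0 + b0 * z.1 + c0 * z.2) - z.1 * (a2 + b2 * z.1 + c2 * z.2))
      + k2 * ((1 - z.1 - z.2) * z.1 * (a1 + b1 * z.1 + c1 * z.2))) :
    (f (0, 1 / 2) + f (1 / 2, 0) + f (1 / 2, 1 / 2)) / 6 - ∫ z in refTriangle, f z =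
      (k0 * (b2 + c2) + k1 * (c0 - 2 * b0) + k2 * (b1 - 2 * c1)) / 240 := by
  have h := integral_refTriangle_quartic (-u1 * a1 + u2 * a0)
    (u0 * a1 - u1 * (b1 - a1) + u2 * (b0 - a0) - u2 * a2 + k2 * a1)
    (-u0 * a0 + u1 * a2 - u1 * (c1 - a1) + u2 * (c0 - a0) + k1 * a0)
    (u0 * b1 + u1 * b1 - u2 * b0 - u2 * b2 + k2 * (b1 - a1))
    (u0 * (c1 - b0) + u1 * b2 + u1 * (b1 + c1) - u2 * (b0 + c0) - u2 * c2 + k0 * a2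
      + k1 * (b0 - a0) + k2 * (c1 - a1))
    (-u0 * c0 + u1 * c2 + u1 * c1 - u2 * c0 + k1 * (c0 - a0))
    (-k2 * b1) (k0 * b2 - k1 * b0 - k2 * (c1 + b1)) (k0 * c2 - k1 * (c0 + b0) - k2 * c1)
    (-k1 * c0) 0 0 0 0 0
  have hI := (integral_congr_ae (μ := volume.restrict refTriangle) (f := f)
    (Filter.Eventually.of_forall fun z => by simp only [hf z]; ring)).trans h
  rw [hI, hf (0, 1 / 2), hf (1 / 2, 0), hf (1 / 2, 1 / 2)]
  ring

theorem abs_le_of_sq_bounds {σ b k0 k1 k2 γ h X N Δ : ℝ} (hh : 0 ≤ h) (hX : 0 ≤ X) (hN : 0 ≤ N)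
    (hΔ : 0 < Δ) (hσ : |σ| ≤ h ^ 2 / 240 * (|b * k0| + |b * k1| + |b * k2|))
    (hb : b ^ 2 * Δ ≤ X ^ 2) (hk0 : k0 ^ 2 * Δ ≤ 1080 * h ^ 2 * N ^ 2)
    (hk1 : k1 ^ 2 * Δ ≤ 1080 * h ^ 2 * N ^ 2) (hk2 : k2 ^ 2 * Δ ≤ 1080 * h ^ 2 * N ^ 2)
    (hγ : h ^ 2 ≤ γ ^ 2 * (Δ / 2)) : |σ| ≤ γ ^ 2 * h * X * N := by
  have hk : ∀ k : ℝ, k ^ 2 * Δ ≤ 1080 * h ^ 2 * N ^ 2 → |b * k| * Δ ≤ 33 * (h * X * N) := by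
    intro k hk
    have h1 : (b ^ 2 * Δ) * (k ^ 2 * Δ) ≤ X ^ 2 * (1080 * h ^ 2 * N ^ 2) :=
      mul_le_mul hb hk (by positivity) (by positivity)
    have h2 : (b * k * Δ) ^ 2 ≤ (33 * (h * X * N)) ^ 2 := by nlinarith [sq_nonneg (h * X * N)]
    have h3 := abs_le_of_sq_le_sq h2 (by positivity)
    calc |b * k| * Δ = |b * k * Δ| := by rw [abs_mul _ Δ, abs_of_pos hΔ]
      _ ≤ _ := h3
  have h0 := hk k0 hk0
  have h1 := hk k1 hk1
  have h2 := hk k2 hk2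
  have hP : 0 ≤ h * X * N := by positivity
  refine le_of_mul_le_mul_right ?_ hΔ
  calc |σ| * Δ ≤ h ^ 2 / 240 * (|b * k0| + |b * k1| + |b * k2|) * Δ := by gcongr
    _ = h ^ 2 / 240 * (|b * k0| * Δ + |b * k1| * Δ + |b * k2| * Δ) := by ring
    _ ≤ h ^ 2 / 240 * (240 * (h * X * N)) := by gcongr; linarith
    _ = h ^ 2 * (h * X * N) := by ring
    _ ≤ γ ^ 2 * (Δ / 2) * (h * X * N) := by gcongr
    _ ≤ γ ^ 2 * Δ * (h * X * N) := by gcongr; linarith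
    _ = γ ^ 2 * h * X * N * Δ := by ring

theorem dot_sq_le (u w : ℝ × ℝ) : dot u w ^ 2 ≤ dot w w * sq2 u := by
  simp only [dot, sq2]
  nlinarith [sq_nonneg (u.1 * w.2 - u.2 * w.1)]

theorem edgeInt_affine_rotation {a : ℝ × ℝ} {b : ℝ} {PE : ℝ × ℝ → ℝ × ℝ}
    (hPE : ∀ x : ℝ × ℝ, PE x = (a.1 - b * x.2, a.2 + b * x.1)) (u w : ℝ × ℝ) :
    edgeInt PE u w = dot (PE u) (w - u) := by
  have : ∀ s : ℝ, dot (PE (u + s • (w - u))) (w - u) = dot (PE u) (w - u) := by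
    intro s
    simp only [hPE, dot, Prod.fst_add, Prod.snd_add, Prod.smul_fst, Prod.smul_snd, Prod.fst_sub,
      Prod.snd_sub, smul_eq_mul]
    ring
  simp [edgeInt, this]

theorem sq_curl_le (u w₁ w₂ : ℝ × ℝ) : (w₁.2 - w₂.1) ^ 2 ≤ 2 * (sq2 u + sq2 w₁ + sq2 w₂) := by
  simp only [sq2]
  nlinarith [sq_nonneg (w₁.2 + w₂.1), sq_nonneg w₁.1, sq_nonneg w₂.2, sq_nonneg u.1,
    sq_nonneg u.2]

set_option maxHeartbeats 1000000 in
/-- For every `γ ≥ 1` there is a constant `C` such that for every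
nondegenerate triangle `K` with `h_K/ρ_K ≤ γ`, every C¹ vector field `E` on a
neighborhood of `K` with Nédélec interpolant `Π_K E = a + b(−y,x)ᵀ`, and every
`v ∈ N0⁺(K)`, the local quadrature error
`σ_K(Π_K E, v) = (|K|/3) Σᵢ (Π_K E)(mᵢ) ⬝ v(mᵢ) − ∫_K (Π_K E) ⬝ v`
satisfies `|σ_K(Π_K E, v)| ≤ C h_K ‖E‖_{H¹(K)} ‖v‖_{L²(K)}`. -/
theorem stmt_18 :
    ∀ γ : ℝ, 1 ≤ γ →
      ∃ C : ℝ,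
        ∀ (p : Fin 3 → ℝ × ℝ), AffineIndependent ℝ p →
        ∀ (K : Set (ℝ × ℝ)), K = convexHull ℝ (Set.range p) →
        ∀ (m : Fin 3 → ℝ × ℝ), (∀ i : Fin 3, m i = midpoint ℝ (p (i + 1)) (p (i + 2))) →
        ediam K ≤ γ * einrad K →
        ∀ (lam : Fin 3 → ℝ × ℝ → ℝ) (g : Fin 3 → ℝ × ℝ) (cc : Fin 3 → ℝ),
          (∀ i x, lam i x = dot (g i) x + cc i) →
          (∀ i j, lam i (p j) = if i = j then 1 else 0) →
        ∀ (Phi0 PhiB : Fin 3 → ℝ × ℝ → ℝ × ℝ),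
          (∀ i x, Phi0 i x = lam i x • g (i + 1) - lam (i + 1) x • g i) →
          (∀ i x, PhiB i x = (lam i x * lam (i + 1) x) • g (i + 2)) →
        ∀ (U : Set (ℝ × ℝ)), IsOpen U → K ⊆ U →
        ∀ (E : ℝ × ℝ → ℝ × ℝ), ContDiffOn ℝ 1 E U →
        ∀ (a : ℝ × ℝ) (b : ℝ) (PE : ℝ × ℝ → ℝ × ℝ),
          (∀ x : ℝ × ℝ, PE x = (a.1 - b * x.2, a.2 + b * x.1)) →
          (∀ i : Fin 3,
            edgeInt PE (p (i + 1)) (p (i + 2)) = edgeInt E (p (i + 1)) (p (i + 2))) →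
        ∀ (v : ℝ × ℝ → ℝ × ℝ) (av bv : Fin 3 → ℝ),
          (∀ x, v x = ∑ i : Fin 3, (av i • Phi0 i x + bv i • PhiB i x)) →
        |((volume K).toReal / 3) * (∑ i : Fin 3, dot (PE (m i)) (v (m i)))
            - ∫ x in K, dot (PE x) (v x)|
          ≤ C * ediam K *
            Real.sqrt (∫ x in K,
              sq2 (E x) + sq2 (fderiv ℝ E x (1, 0)) + sq2 (fderiv ℝ E x (0, 1))) *
            Real.sqrt (∫ x in K, sq2 (v x)) := by
  intro γ hγ
  refine ⟨γ ^ 2, ?_⟩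
  intro p _ K hK m hm hdiam lam g cc hlam hlamp Phi0 PhiB hPhi0 hPhiB U hU hKU E hE a b PE hPE
    hedge v av bv hv
  have i12 : (1 : Fin 3) + 1 = 2 := rfl
  have i21 : (2 : Fin 3) + 1 = 0 := rfl
  have i10 : (1 : Fin 3) + 2 = 0 := rfl
  have i22 : (2 : Fin 3) + 2 = 1 := rfl
  set r := p 2 with hr
  set d := p 0 - p 2 with hd
  set e := p 1 - p 2 with he
  set D := d.1 * e.2 - d.2 * e.1 with hDdef
  set F := triangleMap r d e with hF
  have hp0 : p 0 = r + d := by simp [hr, hd]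
  have hp1 : p 1 = r + e := by simp [hr, he]
  have hg : ∀ i j, dot (g i) (p j - p 2) = (if i = j then 1 else 0) - if i = 2 then 1 else 0 := by
    intro i j
    rw [← hlamp i j, ← hlamp i 2, hlam, hlam]
    simp only [dot, Prod.fst_sub, Prod.snd_sub]
    ring
  have g0d : dot (g 0) d = 1 := by rw [hd, hg]; simp
  have g0e : dot (g 0) e = 0 := by rw [he, hg]; simp
  have g1d : dot (g 1) d = 0 := by rw [hd, hg]; simp
  have g1e : dot (g 1) e = 1 := by rw [he, hg]; simp
  have g2d : dot (g 2) d = -1 := by rw [hd, hg]; simp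
  have g2e : dot (g 2) e = -1 := by rw [he, hg]; simp
  have hD : D ≠ 0 := by
    intro h0
    have h1 : ((g 0).1 * (g 1).2 - (g 0).2 * (g 1).1) * D =
        dot (g 0) d * dot (g 1) e - dot (g 0) e * dot (g 1) d := by
      simp only [dot, hDdef]; ring
    rw [h0, g0d, g0e, g1d, g1e] at h1
    norm_num at h1
  have hΔ : 0 < |D| := abs_pos.2 hD
  have hlamF : ∀ i z, lam i (F z) = lam i (p 2) + z.1 * dot (g i) d + z.2 * dot (g i) e := by
    intro i z
    simp only [hlam, hF, triangleMap, dot, Prod.fst_add, Prod.snd_add, Prod.smul_fst,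
      Prod.smul_snd, smul_eq_mul, hr]
    ring
  have l0 : ∀ z, lam 0 (F z) = z.1 := fun z => by rw [hlamF, hlamp, g0d, g0e]; simp
  have l1 : ∀ z, lam 1 (F z) = z.2 := fun z => by rw [hlamF, hlamp, g1d, g1e]; simp
  have l2 : ∀ z, lam 2 (F z) = 1 - z.1 - z.2 := fun z => by
    rw [hlamF, hlamp, g2d, g2e]; simp; ring
  have hvF : ∀ z, v (F z) =
      av 0 • (z.1 • g 1 - z.2 • g 0) + bv 0 • ((z.1 * z.2) • g 2)
      + (av 1 • (z.2 • g 2 - (1 - z.1 - z.2) • g 1) + bv 1 • ((z.2 * (1 - z.1 - z.2)) • g 0))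
      + (av 2 • ((1 - z.1 - z.2) • g 0 - z.1 • g 2)
        + bv 2 • (((1 - z.1 - z.2) * z.1) • g 1)) := by
    intro z
    simp only [hv, hPhi0, hPhiB, Fin.sum_univ_three, zero_add, i12, i21, i10, i22, l0, l1, l2]
  have hdotv : ∀ z w, dot (v (F z)) w =
      av 0 * (z.1 * dot (g 1) w - z.2 * dot (g 0) w) + bv 0 * (z.1 * z.2 * dot (g 2) w)
      + (av 1 * (z.2 * dot (g 2) w - (1 - z.1 - z.2) * dot (g 1) w)
        + bv 1 * (z.2 * (1 - z.1 - z.2) * dot (g 0) w))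
      + (av 2 * ((1 - z.1 - z.2) * dot (g 0) w - z.1 * dot (g 2) w)
        + bv 2 * ((1 - z.1 - z.2) * z.1 * dot (g 1) w)) := by
    intro z w
    simp only [hvF, dot, Prod.fst_add, Prod.snd_add, Prod.fst_sub, Prod.snd_sub, Prod.smul_fst,
      Prod.smul_snd, smul_eq_mul]
    ring
  have hKim : K = F '' refTriangle := hK.trans (convexHull_range_eq_image_triangleMap p)
  have hKc : IsCompact K := by
    rw [hKim]
    exact isCompact_refTriangle.image (by rw [hF]; unfold triangleMap; fun_prop)
  have hFK : ∀ z ∈ refTriangle, F z ∈ K := fun z hz => hKim ▸ Set.mem_image_of_mem F hz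
  have hint : ∀ f : ℝ × ℝ → ℝ, ∫ x in K, f x = |D| * ∫ z in refTriangle, f (F z) := by
    intro f
    rw [hKim]
    exact setIntegral_triangleMap_image hD f
  have hvol : (volume K).toReal = |D| / 2 := by
    rw [hKim]
    exact volume_triangleMap_image hD
  set h := ediam K
  have hpK : ∀ i, p i ∈ K := fun i => hK ▸ subset_convexHull ℝ _ ⟨i, rfl⟩
  have hdd : dot d d ≤ h ^ 2 := dot_sub_self_le_ediam_sq hKc (hpK 0) (hpK 2)
  have hee : dot e e ≤ h ^ 2 := dot_sub_self_le_ediam_sq hKc (hpK 1) (hpK 2)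
  have hde : dot (d - e) (d - e) ≤ h ^ 2 := by
    have := dot_sub_self_le_ediam_sq hKc (hpK 0) (hpK 1)
    rwa [hp0, hp1, add_sub_add_left_eq_sub] at this
  have hnn : ∀ u, 0 ≤ dot u u := fun u => by simp only [dot]; nlinarith [sq_nonneg u.1]
  have hshape : h ^ 2 ≤ γ ^ 2 * (|D| / 2) := by
    rw [← hvol]
    calc h ^ 2 ≤ (γ * einrad K) ^ 2 := pow_le_pow_left₀ (ediam_nonneg K) hdiam 2
      _ = γ ^ 2 * einrad K ^ 2 := by ring
      _ ≤ _ := by gcongr; exact einrad_sq_le_volume hKc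
  have hsq2 : ∀ u, 0 ≤ sq2 u := fun u => by unfold sq2; positivity
  -- the bubble coefficients are controlled by the `L²` norm of `v`
  have hNsq : Real.sqrt (∫ x in K, sq2 (v x)) ^ 2 = ∫ x in K, sq2 (v x) :=
    Real.sq_sqrt (integral_nonneg fun x => hsq2 _)
  have hvint : IntegrableOn (fun z => sq2 (v (F z))) refTriangle volume := by
    refine ContinuousOn.integrableOn_compact isCompact_refTriangle ?_
    simp only [hvF, sq2]
    fun_prop
  have hcoef : ∀ w k, dot w w ≤ h ^ 2 →
      k ^ 2 ≤ 1080 * ∫ z in refTriangle, dot (v (F z)) w ^ 2 →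
      k ^ 2 * |D| ≤ 1080 * h ^ 2 * Real.sqrt (∫ x in K, sq2 (v x)) ^ 2 := by
    intro w k hw hk
    rw [hNsq, hint]
    have h1 : ∫ z in refTriangle, dot (v (F z)) w ^ 2 ≤
        h ^ 2 * ∫ z in refTriangle, sq2 (v (F z)) := by
      rw [← integral_const_mul]
      refine integral_mono (ContinuousOn.integrableOn_compact isCompact_refTriangle ?_)
        (hvint.const_mul _) fun z => (dot_sq_le _ _).trans ?_
      · simp only [hdotv]
        fun_prop
      · exact mul_le_mul_of_nonneg_right hw (hsq2 _)
    calc k ^ 2 * |D| ≤ 1080 * (h ^ 2 * ∫ z in refTriangle, sq2 (v (F z))) * |D| := by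
          gcongr; linarith
      _ = _ := by ring
  obtain ⟨hq0, hq1, -⟩ := quadratic_coeff_sq_le_integral (av 2) 0 (-(av 0 + av 1 + av 2))
    (-bv 0) (bv 1) 0
  obtain ⟨-, -, hq2⟩ := quadratic_coeff_sq_le_integral (-av 1) (av 0 + av 1 + av 2) 0
    (-bv 0) 0 (bv 2)
  have hfd : ∀ z : ℝ × ℝ, av 2 + 0 * z.1 + -(av 0 + av 1 + av 2) * z.2 + -bv 0 * (z.1 * z.2)
      + bv 1 * (z.2 * (1 - z.1 - z.2)) + 0 * ((1 - z.1 - z.2) * z.1) = dot (v (F z)) d := by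
    intro z
    rw [hdotv, g0d, g1d, g2d]
    ring
  have hfe : ∀ z : ℝ × ℝ, -av 1 + (av 0 + av 1 + av 2) * z.1 + 0 * z.2 + -bv 0 * (z.1 * z.2)
      + 0 * (z.2 * (1 - z.1 - z.2)) + bv 2 * ((1 - z.1 - z.2) * z.1) = dot (v (F z)) e := by
    intro z
    rw [hdotv, g0e, g1e, g2e]
    ring
  simp only [hfd, neg_sq] at hq0 hq1
  simp only [hfe] at hq2
  have hk0 := hcoef d (bv 0) hdd hq0
  have hk1 := hcoef d (bv 1) hdd hq1
  have hk2 := hcoef e (bv 2) hee hq2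
  -- the rotation coefficient of the interpolant is controlled by the curl of `E`
  set G : ℝ × ℝ → ℝ := fun x =>
    sq2 (E x) + sq2 (fderiv ℝ E x (1, 0)) + sq2 (fderiv ℝ E x (0, 1)) with hG
  have hGnn : ∀ x, 0 ≤ G x := fun x => add_nonneg (add_nonneg (hsq2 _) (hsq2 _)) (hsq2 _)
  have hXsq : Real.sqrt (∫ x in K, G x) ^ 2 = ∫ x in K, G x :=
    Real.sq_sqrt (integral_nonneg hGnn)
  have hEK : ContinuousOn E K := hE.continuousOn.mono hKU
  have hdEK : ContinuousOn (fun x => fderiv ℝ E x) K :=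
    (hE.continuousOn_fderiv_of_isOpen hU le_rfl).mono hKU
  have hb : b ^ 2 * |D| ≤ Real.sqrt (∫ x in K, G x) ^ 2 := by
    let curl : ℝ × ℝ → ℝ := fun x => (fderiv ℝ E x (1, 0)).2 - (fderiv ℝ E x (0, 1)).1
    have hcurlc : ContinuousOn curl K := by
      simp only [curl]
      fun_prop
    have hgreen := sum_edgeInt_eq_integral_curl hU hE (r := r) (d := d) (e := e)
      fun z hz => hKU (hFK z hz)
    have s0 := hedge 0
    have s1 := hedge 1
    have s2 := hedge 2
    simp only [zero_add, i12, i21, i10, i22] at s0 s1 s2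
    rw [edgeInt_affine_rotation hPE] at s0 s1 s2
    change dot (PE (p 1)) (r - p 1) = edgeInt E (p 1) r at s0
    change dot (PE r) (p 0 - r) = edgeInt E r (p 0) at s1
    rw [hp1] at s0 s2
    rw [hp0] at s1 s2
    rw [← s0, ← s1, ← s2] at hgreen
    change _ = D * ∫ z in refTriangle, curl (F z) at hgreen
    have h2b : D * b = D * ∫ z in refTriangle, curl (F z) := by
      rw [← hgreen]
      simp only [hPE, dot, hDdef, Prod.fst_add, Prod.snd_add, Prod.fst_sub, Prod.snd_sub]
      ring
    have hcs := sq_setIntegral_le hKc hcurlc (by rw [hvol]; positivity)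
    rw [hint curl, ← mul_left_cancel₀ hD h2b, hvol] at hcs
    have hle : ∫ x in K, curl x ^ 2 ≤ 2 * ∫ x in K, G x := by
      rw [← integral_const_mul]
      have hGi : IntegrableOn G K volume :=
        ContinuousOn.integrableOn_compact hKc (by simp only [hG, sq2]; fun_prop)
      refine integral_mono ((hcurlc.pow 2).integrableOn_compact hKc) (hGi.const_mul 2) fun x => ?_
      exact sq_curl_le (E x) (fderiv ℝ E x (1, 0)) (fderiv ℝ E x (0, 1))
    rw [hXsq]
    refine le_of_mul_le_mul_left ?_ hΔ
    calc |D| * (b ^ 2 * |D|) = (|D| * b) ^ 2 := by ring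
      _ ≤ |D| / 2 * ∫ x in K, curl x ^ 2 := hcs
      _ ≤ |D| / 2 * (2 * ∫ x in K, G x) := by gcongr
      _ = |D| * ∫ x in K, G x := by ring
  -- the quadrature error only sees the rotation and bubble coefficients
  have hm0 : m 0 = F (0, 1 / 2) := by
    rw [hm, midpoint_eq_smul_add]
    simp only [zero_add]
    change (⅟2 : ℝ) • (p 1 + r) = _
    rw [hp1]
    ext <;> simp [hF, triangleMap] <;> ring
  have hm1 : m 1 = F (1 / 2, 0) := by
    rw [hm, midpoint_eq_smul_add, i12, i10]
    change (⅟2 : ℝ) • (r + p 0) = _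
    rw [hp0]
    ext <;> simp [hF, triangleMap] <;> ring
  have hm2 : m 2 = F (1 / 2, 1 / 2) := by
    rw [hm, midpoint_eq_smul_add, i21, i22, hp0, hp1]
    ext <;> simp [hF, triangleMap] <;> ring
  let rot : ℝ × ℝ → ℝ × ℝ → ℝ := fun u w => b * (u.1 * w.2 - u.2 * w.1)
  have hdefect := midpoint_quadrature_defect_refTriangle
    (dot (PE r) (g 0)) (rot d (g 0)) (rot e (g 0))
    (dot (PE r) (g 1)) (rot d (g 1)) (rot e (g 1))
    (dot (PE r) (g 2)) (rot d (g 2)) (rot e (g 2)) (av 0) (av 1) (av 2) (bv 0) (bv 1) (bv 2)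
    (f := fun z => dot (PE (F z)) (v (F z))) (by
      intro z
      simp only [hvF]
      simp only [hPE, rot, hF, triangleMap, dot, Prod.fst_add, Prod.snd_add, Prod.fst_sub,
        Prod.snd_sub, Prod.smul_fst, Prod.smul_snd, smul_eq_mul]
      ring)
  have hrotd : ∀ w, D * rot d w = b * (dot d d * dot w e - dot d e * dot w d) := by
    intro w; simp only [rot, dot, hDdef]; ring
  have hrote : ∀ w, D * rot e w = b * (dot d e * dot w e - dot e e * dot w d) := by
    intro w; simp only [rot, dot, hDdef]; ring
  have hpol : dot (d - e) (d - e) = dot d d + dot e e - 2 * dot d e := by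
    simp only [dot, Prod.fst_sub, Prod.snd_sub]; ring
  have hσ : |(volume K).toReal / 3 * (∑ i : Fin 3, dot (PE (m i)) (v (m i)))
      - ∫ x in K, dot (PE x) (v x)| ≤
      h ^ 2 / 240 * (|b * bv 0| + |b * bv 1| + |b * bv 2|) := by
    have e1 : (volume K).toReal / 3 * (∑ i : Fin 3, dot (PE (m i)) (v (m i)))
        - ∫ x in K, dot (PE x) (v x) = |D| *
        ((bv 0 * (rot d (g 2) + rot e (g 2)) + bv 1 * (rot e (g 0) - 2 * rot d (g 0))
          + bv 2 * (rot d (g 1) - 2 * rot e (g 1))) / 240) := by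
      rw [← hdefect, hvol, hint, Fin.sum_univ_three, hm0, hm1, hm2]
      ring
    have e2 : D * ((bv 0 * (rot d (g 2) + rot e (g 2)) + bv 1 * (rot e (g 0) - 2 * rot d (g 0))
          + bv 2 * (rot d (g 1) - 2 * rot e (g 1))) / 240) =
        (b * bv 0 * (dot e e - dot d d) + b * bv 1 * (dot d d - dot (d - e) (d - e))
          + b * bv 2 * (dot (d - e) (d - e) - dot e e)) / 240 := by
      have x0 := hrotd (g 0)
      have x1 := hrotd (g 1)
      have x2 := hrotd (g 2)
      have y0 := hrote (g 0)
      have y1 := hrote (g 1)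
      have y2 := hrote (g 2)
      rw [g0d, g0e] at x0 y0
      rw [g1d, g1e] at x1 y1
      rw [g2d, g2e] at x2 y2
      rw [hpol]
      linear_combination bv 0 / 240 * (x2 + y2) + bv 1 / 240 * (y0 - 2 * x0)
        + bv 2 / 240 * (x1 - 2 * y1)
    have hterm : ∀ k x y : ℝ, 0 ≤ x → x ≤ h ^ 2 → 0 ≤ y → y ≤ h ^ 2 →
        |k * (x - y)| ≤ h ^ 2 * |k| := by
      intro k x y hx hx' hy hy'
      rw [abs_mul, mul_comm]
      gcongr
      exact abs_le.2 ⟨by linarith, by linarith⟩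
    rw [e1, abs_mul, abs_abs, ← abs_mul, e2, abs_div, abs_of_pos (by norm_num : (0 : ℝ) < 240)]
    have t0 := hterm (b * bv 0) _ _ (hnn e) hee (hnn d) hdd
    have t1 := hterm (b * bv 1) _ _ (hnn d) hdd (hnn (d - e)) hde
    have t2 := hterm (b * bv 2) _ _ (hnn (d - e)) hde (hnn e) hee
    have := abs_add_three (b * bv 0 * (dot e e - dot d d))
      (b * bv 1 * (dot d d - dot (d - e) (d - e))) (b * bv 2 * (dot (d - e) (d - e) - dot e e))
    linarith
  exact abs_le_of_sq_bounds (ediam_nonneg K) (Real.sqrt_nonneg _) (Real.sqrt_nonneg _) hΔ hσ hb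
    hk0 hk1 hk2 hshape
end
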